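/- arXiv:math/0311016 — 8 statements merged into one kernel-verified Lean document; each statement's English description precedes it below -/
import Mathlib

section
/- Let ℤ̂ = ∏_p ℤ_p (product over all primes of the p-adic integers) and ℚ̂ = ℤ̂ ⊗_ℤ ℚ. Then the additive map ℤ̂ × ℚ → ℚ̂ sending (a, q) to a ⊗ 1 − 1 ⊗ q is surjective; that is, every element of ℤ̂ ⊗_ℤ ℚ can be written as a ⊗ 1 − 1 ⊗ q for some a ∈ ℤ̂ and q ∈ ℚ. (This is the surjectivity underlying the homotopy cartesian property of the arithmetic square of ℤ, ℤ̂, ℚ, ℚ̂.) -/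
open scoped TensorProduct

/-- For a prime `p`, the `Fact` instance needed to speak of `ℤ_[p]`. -/
instance (p : Nat.Primes) : Fact (p : ℕ).Prime := ⟨p.2⟩

/-- `ℤ̂ = ∏_p ℤ_p`, the product over all primes of the `p`-adic integers. -/
abbrev Zhat : Type := Π p : Nat.Primes, ℤ_[(p : ℕ)]

/-- The integers surject onto `ℤ̂` modulo a prime `p`. -/
theorem exists_dvd_sub_natCast_of_prime (b : Zhat) (p : Nat.Primes) :
    ∃ m : ℕ, ((p : ℕ) : Zhat) ∣ b - m := by
  refine ⟨(b p).appr 1, pi_dvd_iff.2 fun l => ?_⟩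
  by_cases h : l = p
  · subst h
    simpa [Ideal.mem_span_singleton] using PadicInt.appr_spec 1 (b l)
  · have hne : (l : ℕ).Coprime p :=
      (Nat.coprime_primes l.2 p.2).2 fun e => h (Subtype.ext e)
    exact (PadicInt.isUnit_iff.2 (PadicInt.norm_natCast_eq_one_iff.2 hne)).dvd

/-- The integers surject onto `ℤ̂` modulo any positive integer `n`. -/
theorem exists_dvd_sub_natCast (b : Zhat) {n : ℕ} (hn : n ≠ 0) :
    ∃ m : ℕ, (n : Zhat) ∣ b - m := by
  induction n using induction_on_primes generalizing b with
  | zero => exact absurd rfl hn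
  | one => exact ⟨0, by simp⟩
  | prime_mul p n hp ih =>
    obtain ⟨m, c, hc⟩ := exists_dvd_sub_natCast_of_prime b ⟨p, hp⟩
    obtain ⟨k, d, hd⟩ := ih c (right_ne_zero_of_mul hn)
    refine ⟨m + p * k, d, ?_⟩
    push_cast
    linear_combination hc + (p : Zhat) * hd

/-- **Surjectivity in the arithmetic square.**  Every element of
`ℚ̂ = ℤ̂ ⊗_ℤ ℚ` can be written as `a ⊗ 1 - 1 ⊗ q` with `a ∈ ℤ̂`, `q ∈ ℚ`. -/
theorem arithmeticSquare_surjective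
    (x : Zhat ⊗[ℤ] ℚ) :
    ∃ (a : Zhat) (q : ℚ), x = a ⊗ₜ[ℤ] (1 : ℚ) - (1 : Zhat) ⊗ₜ[ℤ] q := by
  induction x using TensorProduct.induction_on with
  | zero => exact ⟨0, 0, by simp⟩
  | tmul b r =>
    obtain ⟨m, c, hc⟩ := exists_dvd_sub_natCast (r.num • b) r.den_nz
    have hr : r = r.num • (r.den : ℚ)⁻¹ := by
      rw [zsmul_eq_mul, ← div_eq_mul_inv, Rat.num_div_den]
    have hb : r.num • b = m • (1 : Zhat) + r.den • c := by
      rw [nsmul_one, nsmul_eq_mul, ← hc, add_sub_cancel]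
    have hd : r.den • (r.den : ℚ)⁻¹ = 1 := by
      rw [nsmul_eq_mul, mul_inv_cancel₀ (Nat.cast_ne_zero.2 r.den_nz)]
    refine ⟨c, -(m • (r.den : ℚ)⁻¹), ?_⟩
    conv_lhs => rw [hr]
    rw [← TensorProduct.smul_tmul, hb, TensorProduct.add_tmul, TensorProduct.smul_tmul,
      TensorProduct.smul_tmul, hd, TensorProduct.tmul_neg, sub_neg_eq_add, add_comm]
  | add x y hx hy =>
    obtain ⟨a, q, rfl⟩ := hx
    obtain ⟨a', q', rfl⟩ := hy
    refine ⟨a + a', q + q', ?_⟩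
    rw [TensorProduct.add_tmul, TensorProduct.tmul_add]
    abel
end

section
/- Let ℤ̂ = ∏_p ℤ_p (product over all primes of the p-adic integers) and ℚ̂ = ℤ̂ ⊗_ℤ ℚ. The commutative square of ring homomorphisms ℤ → ℤ̂, ℤ → ℚ, ℤ̂ → ℚ̂, ℚ → ℚ̂ is a pullback square: if a ∈ ℤ̂ and q ∈ ℚ have equal images in ℚ̂ (that is, a ⊗ 1 = 1 ⊗ q), then there exists an integer n with a = n·1 in ℤ̂ and q = n in ℚ. -/
open scoped TensorProduct

/-- An equality `a ⊗ 1 = 1 ⊗ q` in `ℚ̂` holds in `ℚ_[p]` after projecting to each prime `p`. -/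
theorem Zhat.coe_apply_eq_of_tmul_eq {a : Zhat} {q : ℚ}
    (h : (a ⊗ₜ[ℤ] (1 : ℚ) : Zhat ⊗[ℤ] ℚ) = (1 : Zhat) ⊗ₜ[ℤ] q) (p : Nat.Primes) :
    (a p : ℚ_[(p : ℕ)]) = (q : ℚ_[(p : ℕ)]) := by
  let f : Zhat →ₐ[ℤ] ℚ_[(p : ℕ)] :=
    (PadicInt.Coe.ringHom.comp (Pi.evalRingHom _ p)).toIntAlgHom
  let g : ℚ →ₐ[ℤ] ℚ_[(p : ℕ)] := (algebraMap ℚ ℚ_[(p : ℕ)]).toIntAlgHom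
  have hfa : f a = (a p : ℚ_[(p : ℕ)]) := rfl
  have hgq : g q = (q : ℚ_[(p : ℕ)]) := eq_ratCast _ q
  have hfg := congrArg (Algebra.TensorProduct.productMap f g) h
  simpa [hfa, hgq] using hfg

/-- A rational number that is a `p`-adic integer has denominator prime to `p`. -/
theorem Padic.not_dvd_den_of_norm_ratCast_le_one {p : ℕ} [Fact p.Prime] {q : ℚ}
    (hq : ‖(q : ℚ_[p])‖ ≤ 1) : ¬ p ∣ q.den := by
  simpa [Nat.Prime.coprime_iff_not_dvd Fact.out] using
    PadicInt.isUnit_iff.1 (PadicInt.isUnit_den q hq)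

/-- **The arithmetic square is a pullback.**  If `a ∈ ℤ̂` and `q ∈ ℚ` have the same
image in `ℚ̂ = ℤ̂ ⊗_ℤ ℚ` (that is, `a ⊗ 1 = 1 ⊗ q`), then both come from a single
integer `n`: `a = n·1` in `ℤ̂` (the diagonal embedding) and `q = n` in `ℚ`. -/
theorem arithmeticSquare_pullback
    (a : Zhat) (q : ℚ)
    (h : (a ⊗ₜ[ℤ] (1 : ℚ) : Zhat ⊗[ℤ] ℚ) = (1 : Zhat) ⊗ₜ[ℤ] q) :
    ∃ n : ℤ, a = (n : Zhat) ∧ q = (n : ℚ) := by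
  have hloc := Zhat.coe_apply_eq_of_tmul_eq h
  have hden : q.den = 1 := Nat.eq_one_iff_not_exists_prime_dvd.2 fun p hp ↦ by
    have : Fact p.Prime := ⟨hp⟩
    exact Padic.not_dvd_den_of_norm_ratCast_le_one (hloc ⟨p, hp⟩ ▸ (a ⟨p, hp⟩).2)
  have hq : q = (q.num : ℚ) := (Rat.coe_int_num_of_den_eq_one hden).symm
  refine ⟨q.num, funext fun p ↦ Subtype.ext ?_, hq⟩
  rw [hloc p, hq]
  simp
end

section
/- Let p be a prime, let 𝔽̄_p be an algebraic closure of the field 𝔽_p = ℤ/pℤ, and let F denote the Frobenius ring endomorphism of the ring 𝕎(𝔽̄_p) of p-typical Witt vectors of 𝔽̄_p. Then for every a ∈ 𝕎(𝔽̄_p) there exists x ∈ 𝕎(𝔽̄_p) with F(x) − x = a; that is, the additive endomorphism F − id of 𝕎(𝔽̄_p) is surjective. -/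
open Polynomial in
/-- The Artin–Schreier equation `y ^ p - y = c` is solvable over an algebraically closed field. -/
theorem IsAlgClosed.exists_pow_sub_self_eq {k : Type*} [Field k] [IsAlgClosed k] {n : ℕ}
    (hn : 1 < n) (c : k) : ∃ y : k, y ^ n - y = c := by
  have hdeg : (X ^ n - (X + C c) : k[X]).degree = n := by
    rw [degree_sub_eq_left_of_degree_lt, degree_X_pow]
    rw [degree_X_pow, degree_X_add_C]
    exact_mod_cast hn
  obtain ⟨y, hy⟩ := IsAlgClosed.exists_root (X ^ n - (X + C c) : k[X])
    (by rw [hdeg]; exact_mod_cast (by lia : n ≠ 0))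
  refine ⟨y, ?_⟩
  simp only [IsRoot.def, eval_sub, eval_pow, eval_X, eval_add, eval_C] at hy
  linear_combination hy

namespace WittVector

theorem frobenius_sub_id_surjective_of_isAlgClosed (p : ℕ) [Fact p.Prime] (k : Type*) [Field k]
    [CharP k p] [IsAlgClosed k] :
    Function.Surjective (fun x : WittVector p k => frobenius x - x) := by
  have hmap : (Ideal.span {(p : ℤ)}).map (algebraMap ℤ (WittVector p k)) =
      Ideal.span {(p : WittVector p k)} := by
    simp [Ideal.map_span]
  have : IsAdicComplete (Ideal.span {(p : ℤ)}) (WittVector p k) := by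
    rw [← IsAdicComplete.map_algebraMap_iff (S := WittVector p k), hmap]
    infer_instance
  let f : WittVector p k →ₗ[ℤ] WittVector p k :=
    (frobenius : WittVector p k →+* WittVector p k).toAddMonoidHom.toIntLinearMap - LinearMap.id
  refine surjective_of_mkQ_comp_surjective (I := Ideal.span {(p : ℤ)}) (f := f) fun z => ?_
  obtain ⟨a, rfl⟩ := Submodule.mkQ_surjective _ z
  obtain ⟨y, hy⟩ := IsAlgClosed.exists_pow_sub_self_eq (Fact.out : p.Prime).one_lt (a.coeff 0)
  obtain ⟨x, rfl⟩ := constantCoeff_surjective p y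
  refine ⟨x, ?_⟩
  rw [LinearMap.comp_apply, ← sub_eq_zero, ← map_sub, Submodule.mkQ_apply,
    Submodule.Quotient.mk_eq_zero, Ideal.smul_top_eq_map, hmap, Submodule.restrictScalars_mem,
    ← ker_constantCoeff, RingHom.mem_ker]
  have hf : f x = frobenius x - x := rfl
  rw [hf, map_sub, map_sub, sub_eq_zero]
  simpa [coeff_frobenius_charP] using hy

end WittVector

/-- **Surjectivity of `F - id` on the Witt vectors of `𝔽̄_p`.**
For every `a` in `𝕎(𝔽̄_p)` there is an `x` with `F(x) - x = a`, where `F` is the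
Witt vector Frobenius. -/
theorem frobenius_sub_id_surjective (p : ℕ) [Fact p.Prime] :
    Function.Surjective
      (fun x : WittVector p (AlgebraicClosure (ZMod p)) =>
        WittVector.frobenius x - x) :=
  WittVector.frobenius_sub_id_surjective_of_isAlgClosed p (AlgebraicClosure (ZMod p))
end

section
/- Let p be a prime, let 𝔽̄_p be an algebraic closure of 𝔽_p = ℤ/pℤ, and let F denote the Frobenius ring endomorphism of the Witt vector ring 𝕎(𝔽̄_p). An element a ∈ 𝕎(𝔽̄_p) satisfies F(a) = a if and only if a lies in the image of the ring homomorphism 𝕎(𝔽_p) → 𝕎(𝔽̄_p) induced (by functoriality of Witt vectors) by the inclusion 𝔽_p ↪ 𝔽̄_p. -/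
/-- In a field extension of `𝔽_p`, the solutions of `x ^ p = x` are the elements of `𝔽_p`. -/
theorem ZMod.mem_range_algebraMap_iff_pow_eq_self (p : ℕ) [Fact p.Prime] {K : Type*} [Field K]
    [Algebra (ZMod p) K] {x : K} :
    x ∈ Set.range (algebraMap (ZMod p) K) ↔ x ^ p = x := by
  have : CharP K p := charP_of_injective_algebraMap (algebraMap (ZMod p) K).injective p
  rw [← Subfield.mem_bot_iff_pow_eq_self K p, ← fieldRange_castHom_eq_bot p,
    Subsingleton.elim (ZMod.castHom dvd_rfl K) (algebraMap (ZMod p) K)]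
  rfl

/-- **Frobenius fixed points of `𝕎(𝔽̄_p)`.**  An element `a` of the Witt vectors of an
algebraic closure of `𝔽_p` satisfies `F(a) = a` if and only if it lies in the image of
`𝕎(𝔽_p) → 𝕎(𝔽̄_p)`, the map induced by the inclusion `𝔽_p ↪ 𝔽̄_p` by functoriality of
Witt vectors. -/
theorem frobenius_fixed_iff_mem_range (p : ℕ) [Fact p.Prime]
    (a : WittVector p (AlgebraicClosure (ZMod p))) :
    WittVector.frobenius a = a ↔
      a ∈ Set.range
        (WittVector.map (algebraMap (ZMod p) (AlgebraicClosure (ZMod p)))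
          : WittVector p (ZMod p) → WittVector p (AlgebraicClosure (ZMod p))) := by
  rw [WittVector.ext_iff]
  simp only [WittVector.coeff_frobenius_charP, ← ZMod.mem_range_algebraMap_iff_pow_eq_self]
  constructor
  · intro h
    choose b hb using h
    exact ⟨WittVector.mk p b, WittVector.ext hb⟩
  · rintro ⟨b, rfl⟩ n
    exact ⟨b.coeff n, rfl⟩
end

section
/- Let p be a prime and let 𝔽̄_p be an algebraic closure of 𝔽_p = ℤ/pℤ. The composite ring homomorphism ℤ_p ≅ 𝕎(𝔽_p) → 𝕎(𝔽̄_p), obtained from the canonical ring isomorphism of the p-adic integers with the Witt vectors of 𝔽_p followed by the map induced by the inclusion 𝔽_p ↪ 𝔽̄_p, is injective, and its range is exactly the subring {a ∈ 𝕎(𝔽̄_p) : F(a) = a} of elements fixed by the Frobenius F. Thus ℤ_p is the subring of 𝕎(𝔽̄_p) of elements a satisfying F(a) = a. -/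
/-- The composite ring homomorphism `ℤ_p ≅ 𝕎(𝔽_p) → 𝕎(𝔽̄_p)`: the canonical isomorphism
of the `p`-adic integers with the Witt vectors of `𝔽_p`, followed by the map induced by
the inclusion `𝔽_p ↪ 𝔽̄_p`. -/
noncomputable def padicToWittClosure (p : ℕ) [Fact p.Prime] :
    ℤ_[p] →+* WittVector p (AlgebraicClosure (ZMod p)) :=
  (WittVector.map (algebraMap (ZMod p) (AlgebraicClosure (ZMod p)))).comp
    (WittVector.equiv p).symm.toRingHom

/-- An element of a field extension of `ZMod p` fixed by the `p`-power map lies in `ZMod p`. -/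
theorem ZMod.exists_algebraMap_eq_of_pow_eq_self {p : ℕ} [Fact p.Prime] {K : Type*} [Field K]
    [Algebra (ZMod p) K] {x : K} (hx : x ^ p = x) :
    ∃ y, algebraMap (ZMod p) K y = x := by
  have : CharP K p := charP_of_injective_algebraMap (algebraMap (ZMod p) K).injective p
  have hmem := (Subfield.mem_bot_iff_pow_eq_self K p).mpr hx
  rw [← fieldRange_castHom_eq_bot p,
    Subsingleton.elim (ZMod.castHom _ K) (algebraMap (ZMod p) K)] at hmem
  exact hmem

/-- **`ℤ_p` is the Frobenius-fixed subring of `𝕎(𝔽̄_p)`.**  The composite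
`ℤ_p ≅ 𝕎(𝔽_p) → 𝕎(𝔽̄_p)` is injective and its range is exactly the set of elements
fixed by the Witt vector Frobenius. -/
theorem padicToWittClosure_injective_range (p : ℕ) [Fact p.Prime] :
    Function.Injective (padicToWittClosure p) ∧
      Set.range (padicToWittClosure p) =
        {a : WittVector p (AlgebraicClosure (ZMod p)) | WittVector.frobenius a = a} := by
  have : CharP (AlgebraicClosure (ZMod p)) p :=
    charP_of_injective_algebraMap (algebraMap (ZMod p) _).injective p
  refine ⟨(WittVector.map_injective _ (algebraMap (ZMod p) _).injective).comp
    (WittVector.equiv p).symm.injective, Set.ext fun a ↦ ⟨?_, fun ha ↦ ?_⟩⟩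
  · rintro ⟨z, rfl⟩
    ext n
    simp only [padicToWittClosure, RingHom.comp_apply, WittVector.coeff_frobenius_charP,
      WittVector.map_coeff, ← map_pow, ZMod.pow_card]
  · have hc (n : ℕ) : a.coeff n ^ p = a.coeff n := by
      rw [← WittVector.coeff_frobenius_charP, ha]
    choose b hb using fun n ↦ ZMod.exists_algebraMap_eq_of_pow_eq_self (hc n)
    refine ⟨WittVector.equiv p (WittVector.mk p b), ?_⟩
    ext n
    simp [padicToWittClosure, WittVector.map_coeff, hb]
end

section
/- Let 𝕎 = ∏_p 𝕎(𝔽̄_p) (product over all primes p of the p-typical Witt vectors of an algebraic closure of 𝔽_p), and let Φ be the ring automorphism of 𝕎 acting as the Witt vector Frobenius on each factor. Then the sequence of additive groups 0 → ∏_p ℤ_p → 𝕎 → 𝕎 → 0 is exact, where the first map is the injective ring homomorphism given on each factor by the composite ℤ_p ≅ 𝕎(𝔽_p) → 𝕎(𝔽̄_p), and the second map is Φ − id. In particular ℤ̂ = ∏_p ℤ_p is the subring of 𝕎 of elements a satisfying Φ(a) = a, and for every a ∈ 𝕎 there exists x ∈ 𝕎 with Φ(x) − x = a. -/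
/-- `𝕎 = ∏_p 𝕎(𝔽̄_p)`, the product over all primes of the Witt vectors of an
algebraic closure of `𝔽_p`. -/
abbrev BigW : Type := Π p : Nat.Primes, WittVector p (AlgebraicClosure (ZMod (p : ℕ)))

/-- The ring automorphism data `Φ` of `𝕎`, acting as the Witt vector Frobenius on each
factor (here as a ring homomorphism). -/
noncomputable def PhiW : BigW →+* BigW :=
  Pi.ringHom fun p => (WittVector.frobenius).comp (Pi.evalRingHom _ p)

/-- The inclusion `ℤ̂ = ∏_p ℤ_p → 𝕎`, given on each factor by the composite
`ℤ_p ≅ 𝕎(𝔽_p) → 𝕎(𝔽̄_p)`. -/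
noncomputable def ZhatToBigW : Zhat →+* BigW :=
  Pi.ringHom fun p =>
    (((WittVector.map (algebraMap (ZMod (p : ℕ)) (AlgebraicClosure (ZMod (p : ℕ))))).comp
        (WittVector.equiv (p : ℕ)).symm.toRingHom)).comp (Pi.evalRingHom _ p)

namespace WittVector

section AlgClosed

variable (p : ℕ) [Fact p.Prime] {k : Type*} [Field k] [IsAlgClosed k]

/-- Artin–Schreier equations are solvable over an algebraically closed field. -/
theorem exists_pow_sub_self_eq (a : k) : ∃ c : k, c ^ p - c = a := by
  have hp : 1 < p := (Fact.out : p.Prime).one_lt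
  have hd : (Polynomial.X ^ p - (Polynomial.X + Polynomial.C a) : Polynomial k).degree = p := by
    rw [Polynomial.degree_sub_eq_left_of_degree_lt]
    · simp
    · rw [Polynomial.degree_X_add_C, Polynomial.degree_X_pow]
      exact_mod_cast hp
  obtain ⟨c, hc⟩ := IsAlgClosed.exists_root
    (Polynomial.X ^ p - (Polynomial.X + Polynomial.C a) : Polynomial k) (by
      rw [hd]
      exact_mod_cast (by lia : p ≠ 0))
  refine ⟨c, ?_⟩
  simp only [Polynomial.IsRoot.def, Polynomial.eval_sub, Polynomial.eval_pow, Polynomial.eval_X,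
    Polynomial.eval_add, Polynomial.eval_C] at hc
  linear_combination hc

variable [CharP k p]

/-- Over an algebraically closed field, `F - id` is surjective modulo `p`. -/
theorem exists_frobenius_sub_self_add_p_mul (a : WittVector p k) :
    ∃ y b : WittVector p k, frobenius y - y + p * b = a := by
  obtain ⟨c, hc⟩ := exists_pow_sub_self_eq p (a.coeff 0)
  have h : a - (frobenius (teichmuller p c) - teichmuller p c) ∈
      Ideal.span {(p : WittVector p k)} := by
    rw [← ker_constantCoeff, RingHom.mem_ker, map_sub, map_sub, constantCoeff_apply,
      constantCoeff_apply, constantCoeff_apply, coeff_frobenius_charP, teichmuller_coeff_zero, hc,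
      sub_self]
  obtain ⟨b, hb⟩ := Ideal.mem_span_singleton.1 h
  exact ⟨teichmuller p c, b, by rw [← hb]; ring⟩

/-- Over an algebraically closed field, `F - id` is surjective on Witt vectors. -/
theorem frobenius_sub_self_surjective :
    Function.Surjective fun x : WittVector p k => frobenius x - x := by
  intro a
  choose y b hyb using exists_frobenius_sub_self_add_p_mul p (k := k)
  let s : ℕ → WittVector p k := fun n =>
    ∑ i ∈ Finset.range n, (p : WittVector p k) ^ i * y (b^[i] a)
  have hs (n : ℕ) : frobenius (s n) - s n + p ^ n * b^[n] a = a := by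
    induction n with
    | zero => simp [s]
    | succ n ih =>
      have h := hyb (b^[n] a)
      simp only [s, Finset.sum_range_succ, map_add, map_mul, map_pow, map_natCast,
        Function.iterate_succ_apply'] at ih ⊢
      linear_combination ih + p ^ n * h
  obtain ⟨x, hx⟩ := IsPrecomplete.prec
    (inferInstance : IsPrecomplete (Ideal.span {(p : WittVector p k)}) (WittVector p k))
    (f := s) (by
      intro m n hmn
      rw [SModEq.comm, SModEq.sub_mem, smul_eq_mul, Ideal.mul_top, Ideal.span_singleton_pow,
        Ideal.mem_span_singleton, ← Finset.sum_Ico_eq_sub _ hmn]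
      exact Finset.dvd_sum fun i hi =>
        (pow_dvd_pow _ (Finset.mem_Ico.1 hi).1).mul_right _)
  refine ⟨x, IsHausdorff.eq_iff_smodEq (I := Ideal.span {(p : WittVector p k)}).2 fun n => ?_⟩
  specialize hx n
  rw [SModEq.sub_mem, smul_eq_mul, Ideal.mul_top, Ideal.span_singleton_pow,
    Ideal.mem_span_singleton] at hx ⊢
  obtain ⟨d, hd⟩ := hx
  have hF := congrArg frobenius hd
  simp only [map_sub, map_mul, map_pow, map_natCast] at hF
  exact ⟨d - frobenius d - b^[n] a, by linear_combination hs n - hF + hd⟩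

end AlgClosed

/-- The Witt vectors fixed by Frobenius are those with coefficients in the prime field. -/
theorem frobenius_eq_self_iff (p : ℕ) [Fact p.Prime] {k : Type*} [Field k] [Algebra (ZMod p) k]
    (a : WittVector p k) :
    frobenius a = a ↔ a ∈ Set.range (map (p := p) (algebraMap (ZMod p) k)) := by
  have : CharP k p := charP_of_injective_algebraMap (algebraMap (ZMod p) k).injective p
  constructor
  · intro h
    have hc (n : ℕ) : ∃ c : ZMod p, algebraMap (ZMod p) k c = a.coeff n := by
      have hn : a.coeff n ^ p = a.coeff n := by rw [← coeff_frobenius_charP, h]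
      rwa [← Subfield.mem_bot_iff_pow_eq_self, ← ZMod.fieldRange_castHom_eq_bot p,
        Subsingleton.elim (ZMod.castHom _ k) (algebraMap (ZMod p) k)] at hn
    choose c hc using hc
    exact ⟨.mk p c, by ext n; simp [hc]⟩
  · rintro ⟨x, rfl⟩
    ext n
    rw [coeff_frobenius_charP, map_coeff, ← map_pow, ZMod.pow_card]

end WittVector

/-- **Exactness of `0 → ℤ̂ → 𝕎 → 𝕎 → 0`.**  The map `ℤ̂ → 𝕎` is injective, its range is
exactly the kernel of `Φ - id` (i.e. the subring of elements fixed by `Φ`), and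
`Φ - id : 𝕎 → 𝕎` is surjective. -/
theorem Zhat_BigW_exact :
    Function.Injective ZhatToBigW ∧
      (∀ a : BigW, PhiW a = a ↔ a ∈ Set.range ZhatToBigW) ∧
      Function.Surjective (fun x : BigW => PhiW x - x) := by
  refine ⟨fun x y h => funext fun p => ?_, fun a => ?_, fun a => ?_⟩
  · exact (WittVector.equiv (p : ℕ)).symm.injective
      (WittVector.map_injective _
        (algebraMap (ZMod (p : ℕ)) (AlgebraicClosure (ZMod (p : ℕ)))).injective (congrFun h p))
  · have hΦ : PhiW a = a ↔ ∀ p, WittVector.frobenius (a p) = a p := funext_iff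
    simp only [hΦ, WittVector.frobenius_eq_self_iff]
    constructor
    · intro h
      choose x hx using h
      refine ⟨fun p => WittVector.equiv (p : ℕ) (x p), funext fun p => ?_⟩
      rw [← hx p]
      exact congrArg (WittVector.map _) ((WittVector.equiv (p : ℕ)).symm_apply_apply (x p))
    · rintro ⟨x, rfl⟩ p
      exact ⟨(WittVector.equiv (p : ℕ)).symm (x p), rfl⟩
  · choose x hx using fun p : Nat.Primes => WittVector.frobenius_sub_self_surjective (p : ℕ) (a p)
    exact ⟨x, funext hx⟩
end

section
/- Let M be a closed model category admitting finite limits and colimits. Then every object of M has a simplicial resolution (equivalently, every object of M^op has a cosimplicial resolution). -/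
open CategoryTheory CategoryTheory.Limits Simplicial Opposite

universe v u


namespace ModelCat

variable {M : Type u} [Category.{v} M]

/-- `f` is a retract of `g` (in the arrow category). -/
def IsRetract {A B X Y : M} (f : A ⟶ B) (g : X ⟶ Y) : Prop :=
  ∃ (i : Arrow.mk f ⟶ Arrow.mk g) (r : Arrow.mk g ⟶ Arrow.mk f), i ≫ r = 𝟙 (Arrow.mk f)

/-- A closed model structure on a category `M` in the sense of Quillen: classes of weak
equivalences, cofibrations and fibrations satisfying the two-out-of-three axiom (CM2),
closure under retracts (CM3), the lifting axiom (CM4) and the factorization axiom (CM5).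
(CM1, the existence of finite limits and colimits, is stated as a typeclass assumption
on `M` where needed.) -/
structure ModelStructure (M : Type u) [Category.{v} M] where
  W : MorphismProperty M
  Cof : MorphismProperty M
  Fib : MorphismProperty M
  /-- CM2, two out of three -/
  W_comp : ∀ {X Y Z : M} (f : X ⟶ Y) (g : Y ⟶ Z), W f → W g → W (f ≫ g)
  W_of_comp_left : ∀ {X Y Z : M} (f : X ⟶ Y) (g : Y ⟶ Z), W g → W (f ≫ g) → W f
  W_of_comp_right : ∀ {X Y Z : M} (f : X ⟶ Y) (g : Y ⟶ Z), W f → W (f ≫ g) → W g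
  /-- CM3, closure under retracts -/
  W_retract : ∀ {A B X Y : M} (f : A ⟶ B) (g : X ⟶ Y), IsRetract f g → W g → W f
  Cof_retract : ∀ {A B X Y : M} (f : A ⟶ B) (g : X ⟶ Y), IsRetract f g → Cof g → Cof f
  Fib_retract : ∀ {A B X Y : M} (f : A ⟶ B) (g : X ⟶ Y), IsRetract f g → Fib g → Fib f
  /-- CM4, lifting -/
  lift_cof_acyclicFib : ∀ {A B X Y : M} (i : A ⟶ B) (p : X ⟶ Y),
    Cof i → Fib p → W p → HasLiftingProperty i p
  lift_acyclicCof_fib : ∀ {A B X Y : M} (i : A ⟶ B) (p : X ⟶ Y),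
    Cof i → W i → Fib p → HasLiftingProperty i p
  /-- CM5, factorization -/
  factor_acyclicCof_fib : ∀ {X Y : M} (f : X ⟶ Y),
    ∃ (Z : M) (i : X ⟶ Z) (p : Z ⟶ Y), Cof i ∧ W i ∧ Fib p ∧ i ≫ p = f
  factor_cof_acyclicFib : ∀ {X Y : M} (f : X ⟶ Y),
    ∃ (Z : M) (i : X ⟶ Z) (p : Z ⟶ Y), Cof i ∧ Fib p ∧ W p ∧ i ≫ p = f

variable (S : ModelStructure M)

/-- An object is cofibrant if the map from the initial object is a cofibration. -/
def ModelStructure.Cofibrant [HasInitial M] (A : M) : Prop :=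
  S.Cof (initial.to A)

/-- An object is fibrant if the map to the terminal object is a fibration. -/
def ModelStructure.Fibrant [HasTerminal M] (A : M) : Prop :=
  S.Fib (terminal.from A)

end ModelCat
namespace ModelCat

variable {M : Type u} [Category.{v} M]

/-- The compatibility condition satisfied by the canonical maps to the copies
`(dᵢ, Yₙ₊₁)` of `Yₙ₊₁` in the diagram defining the matching object `Mₙ₊₁` (the dual of
the latching object): the two composites through each object `(dᵢdⱼ, Yₙ)` agree. -/
def MatchingCompat (Y : SimplicialObject M) (n : ℕ) {T : M}
    (t : Fin (n + 3) → (T ⟶ Y.obj (op (SimplexCategory.mk (n + 1))))) : Prop :=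
  ∀ (i j : Fin (n + 2)), i ≤ j →
    t j.succ ≫ Y.δ i = t i.castSucc ≫ Y.δ j

/-- A simplicial object `Y` in `M` is a simplicial resolution if it is a cosimplicial
resolution in the opposite category `Mᵒᵖ`.  Explicitly: `Y₀` is fibrant, every face map
is an acyclic fibration, and for each `n ≥ 0` the canonical map `Yₙ₊₁ → Mₙ` to the
`n`-th matching object (the limit dual to the latching colimit, quantified below via
its universal property over all objects realizing it) is a fibration; for `n = 0` the
matching object is the product `Y₀ × Y₀`. -/
structure IsSimplicialResolution [HasTerminal M] (S : ModelStructure M)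
    (Y : SimplicialObject M) : Prop where
  /-- `Y₀` is fibrant. -/
  fibrant₀ : S.Fib (terminal.from (Y.obj (op (SimplexCategory.mk 0))))
  /-- Each face map is a fibration… -/
  face_fib : ∀ {n : ℕ} (i : Fin (n + 2)), S.Fib (Y.δ i)
  /-- …and a weak equivalence. -/
  face_W : ∀ {n : ℕ} (i : Fin (n + 2)), S.W (Y.δ i)
  /-- The canonical map `Y₁ → M₀ = Y₀ × Y₀` is a fibration. -/
  matching₀ : ∀ (P : M) (π : Fin 2 → (P ⟶ Y.obj (op (SimplexCategory.mk 0)))),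
    (∀ (T : M) (t : Fin 2 → (T ⟶ Y.obj (op (SimplexCategory.mk 0)))),
      ∃! u : T ⟶ P, ∀ k, u ≫ π k = t k) →
    ∀ f : Y.obj (op (SimplexCategory.mk 1)) ⟶ P, (∀ k, f ≫ π k = Y.δ k) → S.Fib f
  /-- For `n ≥ 1`, the canonical map `Yₙ₊₂ → Mₙ₊₁` is a fibration. -/
  matching : ∀ (n : ℕ) (P : M) (π : Fin (n + 3) → (P ⟶ Y.obj (op (SimplexCategory.mk (n + 1))))),
    MatchingCompat Y n π →
    (∀ (T : M) (t : Fin (n + 3) → (T ⟶ Y.obj (op (SimplexCategory.mk (n + 1))))),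
      MatchingCompat Y n t → ∃! u : T ⟶ P, ∀ k, u ≫ π k = t k) →
    ∀ f : Y.obj (op (SimplexCategory.mk (n + 2))) ⟶ P, (∀ k, f ≫ π k = Y.δ k) → S.Fib f

end ModelCat
namespace ModelCat

variable {M : Type u} [Category.{v} M]

section Families

theorem exists_coequalizer_of_families [HasFiniteColimits M] {ι ρ : Type*} [Finite ι] [Finite ρ]
    {V : ι → M} {U : ρ → M} {i j : ρ → ι} (f : ∀ r, U r ⟶ V (i r)) (g : ∀ r, U r ⟶ V (j r)) :
    ∃ (Q : M) (q : ∀ k, V k ⟶ Q), (∀ r, f r ≫ q (i r) = g r ≫ q (j r)) ∧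
      (∀ (E : M) (e : ∀ k, V k ⟶ E), (∀ r, f r ≫ e (i r) = g r ≫ e (j r)) →
        ∃ u : Q ⟶ E, ∀ k, q k ≫ u = e k) ∧
      ∀ (E : M) (u v : Q ⟶ E), (∀ k, q k ≫ u = q k ≫ v) → u = v := by
  let s : (∐ U) ⟶ ∐ V := Sigma.desc fun r => f r ≫ Sigma.ι V (i r)
  let t : (∐ U) ⟶ ∐ V := Sigma.desc fun r => g r ≫ Sigma.ι V (j r)
  refine ⟨coequalizer s t, fun k => Sigma.ι V k ≫ coequalizer.π s t, fun r => ?_,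
    fun E e he => ⟨coequalizer.desc (Sigma.desc e) (Sigma.hom_ext _ _ fun r => ?_), fun k => ?_⟩,
    fun E u v h => coequalizer.hom_ext (Sigma.hom_ext _ _ fun k => ?_)⟩
  · simpa [s, t] using Sigma.ι U r ≫= coequalizer.condition s t
  · simp [s, t, he]
  · simp
  · simpa using h k

theorem exists_equalizer_of_families [HasFiniteLimits M] {ι ρ : Type*} [Finite ι] [Finite ρ]
    {V : ι → M} {U : ρ → M} {i j : ρ → ι} (f : ∀ r, V (i r) ⟶ U r) (g : ∀ r, V (j r) ⟶ U r) :
    ∃ (Q : M) (q : ∀ k, Q ⟶ V k), (∀ r, q (i r) ≫ f r = q (j r) ≫ g r) ∧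
      (∀ (T : M) (e : ∀ k, T ⟶ V k), (∀ r, e (i r) ≫ f r = e (j r) ≫ g r) →
        ∃ u : T ⟶ Q, ∀ k, u ≫ q k = e k) ∧
      ∀ (T : M) (u v : T ⟶ Q), (∀ k, u ≫ q k = v ≫ q k) → u = v := by
  let s : (∏ᶜ V) ⟶ ∏ᶜ U := Pi.lift fun r => Pi.π V (i r) ≫ f r
  let t : (∏ᶜ V) ⟶ ∏ᶜ U := Pi.lift fun r => Pi.π V (j r) ≫ g r
  refine ⟨equalizer s t, fun k => equalizer.ι s t ≫ Pi.π V k, fun r => ?_,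
    fun T e he => ⟨equalizer.lift (Pi.lift e) (Pi.hom_ext _ _ fun r => ?_), fun k => ?_⟩,
    fun T u v h => equalizer.hom_ext (Pi.hom_ext _ _ fun k => ?_)⟩
  · simpa [s, t] using equalizer.condition s t =≫ Pi.π U r
  · simp [s, t, he]
  · simp
  · simpa using h k

end Families

section ModelStructure

variable (S : ModelStructure M)

theorem ModelStructure.fib_of_hasLiftingProperty {X Y : M} (f : X ⟶ Y)
    (h : ∀ {A B : M} (i : A ⟶ B), S.Cof i → S.W i → HasLiftingProperty i f) : S.Fib f := by
  obtain ⟨Z, i, p, hi, hi', hp, rfl⟩ := S.factor_acyclicCof_fib f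
  have := h i hi hi'
  have sq : CommSq (𝟙 X) i (i ≫ p) p := ⟨by simp⟩
  exact S.Fib_retract _ p ⟨Arrow.homMk i (𝟙 _) (by simp), Arrow.homMk sq.lift (𝟙 _) (by simp),
    by ext <;> simp⟩ hp

theorem ModelStructure.W_of_hasLiftingProperty {X Y : M} (f : X ⟶ Y)
    (h : ∀ {A B : M} (q : A ⟶ B), S.Fib q → HasLiftingProperty f q) : S.W f := by
  obtain ⟨Z, i, p, hi, hi', hp, hf⟩ := S.factor_acyclicCof_fib f
  have := h p hp
  have sq : CommSq i f p (𝟙 Y) := ⟨by simp [hf]⟩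
  exact S.W_retract _ i ⟨Arrow.homMk (𝟙 _) sq.lift (by simp), Arrow.homMk (𝟙 _) p (by simp [hf]),
    by ext <;> simp⟩ hi'

theorem ModelStructure.fib_of_iso {X Y X' Y' : M} (f : X ⟶ Y) (f' : X' ⟶ Y') (a : X ⟶ X')
    (b : Y ⟶ Y') [IsIso a] [IsIso b] (h : a ≫ f' = f ≫ b) (hf : S.Fib f') : S.Fib f :=
  S.Fib_retract f f' ⟨Arrow.homMk a b h, Arrow.homMk (inv a) (inv b) (by
    simp [IsIso.inv_comp_eq, h]), by ext <;> simp⟩ hf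

end ModelStructure

section SimplexCategory

/-- A degeneracy operator: an epimorphism of `SimplexCategory` that lowers the dimension. -/
def IsDegeneracy {d a : SimplexCategory} (e : d ⟶ a) : Prop :=
  Epi e ∧ a.len < d.len

theorem isDegeneracy_of_not_mono {d a b : SimplexCategory} (e : d ⟶ a) (i : a ⟶ b) [Epi e]
    [Mono i] (h : ¬ Mono (e ≫ i)) : IsDegeneracy e := by
  refine ⟨inferInstance, (SimplexCategory.len_le_of_epi e).lt_of_ne fun hl => h ?_⟩
  obtain rfl : a = d := SimplexCategory.ext hl
  rw [SimplexCategory.eq_id_of_epi e]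
  simpa

theorem not_mono_of_len_lt {d a : SimplexCategory} (f : d ⟶ a) (h : a.len < d.len) : ¬ Mono f :=
  fun _ => (SimplexCategory.len_le_of_mono f).not_gt h

theorem IsDegeneracy.not_mono {d a : SimplexCategory} {e : d ⟶ a} (h : IsDegeneracy e) :
    ¬ Mono e :=
  not_mono_of_len_lt e h.2

theorem not_mono_comp {d a b : SimplexCategory} {f : d ⟶ a} (h : ¬ Mono f) (g : a ⟶ b) :
    ¬ Mono (f ≫ g) :=
  fun _ => h (mono_of_mono f g)

instance (d : SimplexCategory) :
    Finite {x : Σ a : SimplexCategory, (d ⟶ a) // IsDegeneracy x.2} := by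
  have : Finite (Σ k : Fin d.len, (d ⟶ SimplexCategory.mk k)) := inferInstance
  refine Finite.of_injective (β := Σ k : Fin d.len, (d ⟶ SimplexCategory.mk k))
    (fun x => ⟨⟨x.1.1.len, x.2.2⟩, x.1.2⟩) ?_
  rintro ⟨⟨⟨a⟩, e⟩, he⟩ ⟨⟨⟨b⟩, e'⟩, he'⟩ h
  simp only [Sigma.mk.injEq, Fin.mk.injEq] at h
  obtain ⟨rfl, h⟩ := h
  obtain rfl := eq_of_heq h
  rfl

end SimplexCategory

/-- A map from the constant simplicial object `Z` to `X`. -/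
structure Coaugmentation (Z : M) (X : SimplicialObject M) where
  app (a : SimplexCategory) : Z ⟶ X.obj (op a)
  w {a b : SimplexCategory} (f : a ⟶ b) : app b ≫ X.map f.op = app a

attribute [simp] Coaugmentation.w

variable {Z : M} {X : SimplicialObject M}

/-- The maps out of the relative latching object of `Z ⟶ X` at `d`. -/
@[ext]
structure LatchingFamily (z : Coaugmentation Z X) (d : SimplexCategory) (E : M) where
  map {a : SimplexCategory} (e : d ⟶ a) (he : IsDegeneracy e) : X.obj (op a) ⟶ E
  pt : Z ⟶ E
  w {a b : SimplexCategory} (e : d ⟶ a) (he : IsDegeneracy e) (g : a ⟶ b)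
    (hg : IsDegeneracy (e ≫ g)) : X.map g.op ≫ map e he = map (e ≫ g) hg
  app_map {a : SimplexCategory} (e : d ⟶ a) (he : IsDegeneracy e) : z.app a ≫ map e he = pt

attribute [simp] LatchingFamily.app_map

namespace LatchingFamily

variable {z : Coaugmentation Z X} {d : SimplexCategory}

theorem w_of_eq {E : M} (L : LatchingFamily z d E) {a b : SimplexCategory} {e : d ⟶ a}
    (he : IsDegeneracy e) (g : a ⟶ b) {e' : d ⟶ b} (h : e ≫ g = e') (he' : IsDegeneracy e') :
    X.map g.op ≫ L.map e he = L.map e' he' := by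
  subst h
  exact L.w e he g he'

/-- Postcomposition of a latching family with a morphism. -/
@[simps]
def post {E E' : M} (L : LatchingFamily z d E) (h : E ⟶ E') : LatchingFamily z d E' where
  map e he := L.map e he ≫ h
  pt := L.pt ≫ h
  w e he g hg := by rw [← Category.assoc, L.w]
  app_map e he := by rw [← Category.assoc, L.app_map]

theorem post_post {E E' E'' : M} (L : LatchingFamily z d E) (h : E ⟶ E') (k : E' ⟶ E'') :
    (L.post h).post k = L.post (h ≫ k) := by
  ext <;> simp

/-- A latching family with target `Y` is acyclic if the induced map from the relative latching
object to `Y` has the left lifting property with respect to fibrations. -/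
def Acyclic (S : ModelStructure M) {Y : M} (L : LatchingFamily z d Y) : Prop :=
  ∀ ⦃E B : M⦄ (q : E ⟶ B), S.Fib q → ∀ (φ : LatchingFamily z d E) (b : Y ⟶ B),
    φ.post q = L.post b → ∃ c : Y ⟶ E, c ≫ q = b ∧ L.post c = φ

/-- The value of a latching family at a noninjective map. -/
noncomputable def ext' {E : M} (L : LatchingFamily z d E) {a : SimplexCategory} (f : d ⟶ a)
    (hf : ¬ Mono f) : X.obj (op a) ⟶ E :=
  X.map (image.ι f).op ≫ L.map (factorThruImage f)
    (isDegeneracy_of_not_mono _ (image.ι f) (by simpa using hf))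

theorem ext'_eq {E : M} (L : LatchingFamily z d E) {a b : SimplexCategory} (e : d ⟶ a)
    (he : IsDegeneracy e) (i : a ⟶ b) (hf : ¬ Mono (e ≫ i)) :
    L.ext' (e ≫ i) hf = X.map i.op ≫ L.map e he := by
  have := he.1
  have hs : IsDegeneracy (factorThruImage (e ≫ i)) :=
    isDegeneracy_of_not_mono _ (image.ι (e ≫ i)) (by simpa using hf)
  have := isSplitEpi_of_epi e
  have h1 : section_ e ≫ factorThruImage (e ≫ i) ≫ image.ι (e ≫ i) = i := by simp
  have h2 : e ≫ section_ e ≫ factorThruImage (e ≫ i) = factorThruImage (e ≫ i) := by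
    rw [← cancel_mono (image.ι (e ≫ i))]
    simp
  have h3 := L.w e he (section_ e ≫ factorThruImage (e ≫ i)) (by rwa [h2])
  simp only [h2] at h3
  dsimp only [ext']
  rw [← h3, ← X.map_comp_assoc, ← op_comp, Category.assoc, h1]

theorem ext'_of_isDegeneracy {E : M} (L : LatchingFamily z d E) {a : SimplexCategory}
    (e : d ⟶ a) (he : IsDegeneracy e) (hf : ¬ Mono e) : L.ext' e hf = L.map e he := by
  have := L.ext'_eq e he (𝟙 a) (by simpa using hf)
  simpa using this

theorem map_ext' {E : M} (L : LatchingFamily z d E) {a b : SimplexCategory} (f : d ⟶ a)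
    (hf : ¬ Mono f) (g : a ⟶ b) (hg : ¬ Mono (f ≫ g)) :
    X.map g.op ≫ L.ext' f hf = L.ext' (f ≫ g) hg := by
  have hs : IsDegeneracy (factorThruImage f) :=
    isDegeneracy_of_not_mono _ (image.ι f) (by simpa using hf)
  have h : factorThruImage f ≫ image.ι f ≫ g = f ≫ g := by simp
  have := L.ext'_eq _ hs (image.ι f ≫ g) (by rwa [h])
  simp only [h] at this
  rw [this]
  simp [ext']

@[simp]
theorem app_ext' {E : M} (L : LatchingFamily z d E) {a : SimplexCategory} (f : d ⟶ a)
    (hf : ¬ Mono f) : z.app a ≫ L.ext' f hf = L.pt := by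
  simp [ext', reassoc_of% z.w]

end LatchingFamily

/-- The latching family with target `X_d` given by the degeneracies of `X`. -/
@[simps]
def Coaugmentation.latching (z : Coaugmentation Z X) (d : SimplexCategory) :
    LatchingFamily z d (X.obj (op d)) where
  map e _ := X.map e.op
  pt := z.app d
  w e _ g _ := by simp
  app_map := by simp

theorem LatchingFamily.ext'_comp_of_post_eq {z : Coaugmentation Z X} {d : SimplexCategory} {Y : M}
    {L : LatchingFamily z d Y} {p : Y ⟶ X.obj (op d)} (h : L.post p = z.latching d)
    {a : SimplexCategory} (f : d ⟶ a) (hf : ¬ Mono f) : L.ext' f hf ≫ p = X.map f.op := by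
  have hs : IsDegeneracy (factorThruImage f) :=
    isDegeneracy_of_not_mono _ (image.ι f) (by simpa using hf)
  have h' : L.map _ hs ≫ p = X.map (factorThruImage f).op :=
    congr_arg (fun ψ : LatchingFamily z d _ => ψ.map _ hs) h
  rw [LatchingFamily.ext', Category.assoc, h', ← X.map_comp, ← op_comp, image.fac]

/-- The relative latching object exists. -/
theorem exists_universal_latchingFamily [HasFiniteColimits M] (z : Coaugmentation Z X)
    (d : SimplexCategory) :
    ∃ (Q : M) (L : LatchingFamily z d Q),
      (∀ (E : M) (φ : LatchingFamily z d E), ∃ u : Q ⟶ E, L.post u = φ) ∧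
      ∀ (E : M) (u v : Q ⟶ E), L.post u = L.post v → u = v := by
  let I := {x : Σ a : SimplexCategory, (d ⟶ a) // IsDegeneracy x.2}
  let R := Σ (i j : I), {g : i.1.1 ⟶ j.1.1 // i.1.2 ≫ g = j.1.2}
  let V : Option I → M := fun k => k.elim Z fun i => X.obj (op i.1.1)
  let U : R ⊕ I → M := Sum.elim (fun r => V (some r.2.1)) fun _ => Z
  let i : R ⊕ I → Option I := Sum.elim (fun r => some r.1) some
  let j : R ⊕ I → Option I := Sum.elim (fun r => some r.2.1) fun _ => none
  let f : ∀ r, U r ⟶ V (i r) := fun r => match r with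
    | .inl r => X.map r.2.2.1.op
    | .inr i => z.app i.1.1
  let g : ∀ r, U r ⟶ V (j r) := fun r => match r with
    | .inl _ => 𝟙 _
    | .inr _ => 𝟙 _
  obtain ⟨Q, q, hq, hq', hq''⟩ := exists_coequalizer_of_families f g
  let L : LatchingFamily z d Q :=
    { map := fun {a} e he => q (some ⟨⟨a, e⟩, he⟩)
      pt := q none
      w := fun {a b} e he g hg =>
        (hq (.inl ⟨⟨⟨a, e⟩, he⟩, ⟨⟨b, e ≫ g⟩, hg⟩, ⟨g, rfl⟩⟩)).trans (Category.id_comp _)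
      app_map := fun {a} e he => (hq (.inr ⟨⟨a, e⟩, he⟩)).trans (Category.id_comp _) }
  refine ⟨Q, L, fun E φ => ?_, fun E u v h => hq'' E u v ?_⟩
  · obtain ⟨u, hu⟩ := hq' E (fun k => match k with
      | none => φ.pt
      | some i => φ.map i.1.2 i.2) (by
        rintro (⟨⟨⟨a, e⟩, he⟩, ⟨⟨b, e'⟩, he'⟩, ⟨g, hg⟩⟩ | ⟨⟨a, e⟩, he⟩)
        · exact (φ.w_of_eq he g hg he').trans (Category.id_comp _).symm
        · exact (φ.app_map e he).trans (Category.id_comp _).symm)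
    exact ⟨u, LatchingFamily.ext (by funext a e he; exact hu (some ⟨⟨a, e⟩, he⟩)) (hu none)⟩
  · rintro (_ | ⟨⟨a, e⟩, he⟩)
    · exact congr_arg LatchingFamily.pt h
    · exact congr_arg (fun ψ : LatchingFamily z d E => ψ.map e he) h

/-- A factorization of the relative matching map of `Z ⟶ X` at `d`. -/
structure Cell (z : Coaugmentation Z X) (d : SimplexCategory) where
  Y : M
  p : Y ⟶ X.obj (op d)
  L : LatchingFamily z d Y
  post_p : L.post p = z.latching d

theorem exists_cell [HasFiniteColimits M] (S : ModelStructure M) (z : Coaugmentation Z X)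
    (d : SimplexCategory) : ∃ C : Cell z d, S.Fib C.p ∧ C.L.Acyclic S := by
  obtain ⟨Q, L, hL, hL'⟩ := exists_universal_latchingFamily z d
  obtain ⟨u, hu⟩ := hL _ (z.latching d)
  obtain ⟨Y, i, p, hi, hi', hp, rfl⟩ := S.factor_acyclicCof_fib u
  refine ⟨⟨Y, p, L.post i, by rw [L.post_post, hu]⟩, hp, fun E B q hq φ b h => ?_⟩
  obtain ⟨u', rfl⟩ := hL _ φ
  have sq : CommSq u' i q b := ⟨hL' _ _ _ (by simpa [L.post_post] using h)⟩
  have := S.lift_acyclicCof_fib i q hi hi' hq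
  exact ⟨sq.lift, by simp, by rw [L.post_post, sq.fac_left]⟩

namespace Cell

variable [HasFiniteLimits M] {z : Coaugmentation Z X} {d : SimplexCategory} (C : Cell z d)

/-- An object of `a`-simplices of `C.attach`: it classifies an `a`-simplex of `X` together with
compatible lifts to `C.Y` of its restrictions along all maps `d ⟶ a`, which are prescribed for
the noninjective ones. -/
structure Simplices (a : SimplexCategory) where
  obj : M
  base : obj ⟶ X.obj (op a)
  comp (f : d ⟶ a) : obj ⟶ C.Y
  comp_p (f : d ⟶ a) : comp f ≫ C.p = base ≫ X.map f.op
  comp_of_not_mono (f : d ⟶ a) (hf : ¬ Mono f) : comp f = base ≫ C.L.ext' f hf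
  exists_lift {T : M} (x : T ⟶ X.obj (op a)) (y : (d ⟶ a) → (T ⟶ C.Y))
    (h : ∀ f, y f ≫ C.p = x ≫ X.map f.op) (h' : ∀ f hf, y f = x ≫ C.L.ext' f hf) :
    ∃ u : T ⟶ obj, u ≫ base = x ∧ ∀ f, u ≫ comp f = y f
  hom_ext {T : M} {u v : T ⟶ obj} (h : u ≫ base = v ≫ base)
    (h' : ∀ f, u ≫ comp f = v ≫ comp f) : u = v

theorem nonempty_simplices (a : SimplexCategory) : Nonempty (C.Simplices a) := by
  let V : Option (d ⟶ a) → M := fun k => k.elim (X.obj (op a)) fun _ => C.Y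
  let U : (d ⟶ a) ⊕ {f : d ⟶ a // ¬ Mono f} → M := Sum.elim (fun _ => X.obj (op d)) fun _ => C.Y
  let i : (d ⟶ a) ⊕ {f : d ⟶ a // ¬ Mono f} → Option (d ⟶ a) := Sum.elim some fun f => some f.1
  let j : (d ⟶ a) ⊕ {f : d ⟶ a // ¬ Mono f} → Option (d ⟶ a) := fun _ => none
  let s : ∀ r, V (i r) ⟶ U r := fun r => match r with
    | .inl _ => C.p
    | .inr _ => 𝟙 _
  let t : ∀ r, V (j r) ⟶ U r := fun r => match r with
    | .inl f => X.map f.op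
    | .inr f => C.L.ext' f.1 f.2
  obtain ⟨Q, q, hq, hq', hq''⟩ := exists_equalizer_of_families s t
  refine ⟨⟨Q, q none, fun f => q (some f), fun f => hq (.inl f),
    fun f hf => (Category.comp_id _).symm.trans (hq (.inr ⟨f, hf⟩)), fun {T} x y h h' => ?_,
    fun {T} u v h hY => hq'' T u v ?_⟩⟩
  · obtain ⟨u, hu⟩ := hq' T (fun k => match k with
      | none => x
      | some f => y f) (by
        rintro (f | ⟨f, hf⟩)
        · exact h f
        · exact (Category.comp_id _).trans (h' f hf))
    exact ⟨u, hu none, fun f => hu (some f)⟩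
  · rintro (_ | f)
    exacts [h, hY f]

/-- The `a`-simplices of `C.attach`. -/
noncomputable def attachObj (a : SimplexCategory) : M :=
  (C.nonempty_simplices a).some.obj

/-- The underlying simplex in `X`. -/
noncomputable def base (a : SimplexCategory) : C.attachObj a ⟶ X.obj (op a) :=
  (C.nonempty_simplices a).some.base

/-- The component in `C.Y` of a simplex of `C.attach`, for each `d`-dimensional face. -/
noncomputable def comp {a : SimplexCategory} (f : d ⟶ a) : C.attachObj a ⟶ C.Y :=
  (C.nonempty_simplices a).some.comp f

@[simp]
theorem comp_p {a : SimplexCategory} (f : d ⟶ a) : C.comp f ≫ C.p = C.base a ≫ X.map f.op :=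
  (C.nonempty_simplices a).some.comp_p f

theorem comp_of_not_mono {a : SimplexCategory} (f : d ⟶ a) (hf : ¬ Mono f) :
    C.comp f = C.base a ≫ C.L.ext' f hf :=
  (C.nonempty_simplices a).some.comp_of_not_mono f hf

theorem attachObj_hom_ext {a : SimplexCategory} {T : M} {u v : T ⟶ C.attachObj a}
    (h : u ≫ C.base a = v ≫ C.base a) (h' : ∀ f, u ≫ C.comp f = v ≫ C.comp f) : u = v :=
  (C.nonempty_simplices a).some.hom_ext h h'

theorem exists_lift {a : SimplexCategory} {T : M} (x : T ⟶ X.obj (op a))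
    (y : (d ⟶ a) → (T ⟶ C.Y)) (h : ∀ f, y f ≫ C.p = x ≫ X.map f.op)
    (h' : ∀ f hf, y f = x ≫ C.L.ext' f hf) :
    ∃ u : T ⟶ C.attachObj a, u ≫ C.base a = x ∧ ∀ f, u ≫ C.comp f = y f :=
  (C.nonempty_simplices a).some.exists_lift x y h h'

theorem exists_attachMap {a b : SimplexCategory} (g : a ⟶ b) :
    ∃ u : C.attachObj b ⟶ C.attachObj a, u ≫ C.base a = C.base b ≫ X.map g.op ∧
      ∀ f, u ≫ C.comp f = C.comp (f ≫ g) :=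
  C.exists_lift _ _ (by simp) fun f hf => by
    rw [C.comp_of_not_mono _ (not_mono_comp hf g), Category.assoc, C.L.map_ext']

/-- The simplicial structure maps of `C.attach`. -/
noncomputable def attachMap {a b : SimplexCategory} (g : a ⟶ b) :
    C.attachObj b ⟶ C.attachObj a :=
  (C.exists_attachMap g).choose

@[simp]
theorem attachMap_base {a b : SimplexCategory} (g : a ⟶ b) :
    C.attachMap g ≫ C.base a = C.base b ≫ X.map g.op :=
  (C.exists_attachMap g).choose_spec.1

@[simp]
theorem attachMap_comp {a b : SimplexCategory} (g : a ⟶ b) (f : d ⟶ a) :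
    C.attachMap g ≫ C.comp f = C.comp (f ≫ g) :=
  (C.exists_attachMap g).choose_spec.2 f

@[simp]
theorem attachMap_base_assoc {a b : SimplexCategory} (g : a ⟶ b) {T : M}
    (h : X.obj (op a) ⟶ T) :
    C.attachMap g ≫ C.base a ≫ h = C.base b ≫ X.map g.op ≫ h := by
  rw [← Category.assoc, attachMap_base, Category.assoc]

@[simp]
theorem attachMap_comp_assoc {a b : SimplexCategory} (g : a ⟶ b) (f : d ⟶ a) {T : M}
    (h : C.Y ⟶ T) : C.attachMap g ≫ C.comp f ≫ h = C.comp (f ≫ g) ≫ h := by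
  rw [← Category.assoc, attachMap_comp]

/-- The simplicial object obtained from `X` by replacing the object of `d`-simplices by `C.Y` and
adjusting the objects of simplices of higher dimension. -/
@[simps]
noncomputable def attach : SimplicialObject M where
  obj a := C.attachObj a.unop
  map g := C.attachMap g.unop
  map_id a := C.attachObj_hom_ext (by simp) (by simp)
  map_comp f g := C.attachObj_hom_ext (by simp) (by simp)

/-- The projection from `C.attach` to `X`. -/
@[simps]
noncomputable def proj : C.attach ⟶ X where
  app a := C.base a.unop
  naturality _ _ f := C.attachMap_base f.unop

theorem exists_coaugmentation :
    ∃ z' : Coaugmentation Z C.attach, (∀ a, z'.app a ≫ C.base a = z.app a) ∧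
      ∀ a (f : d ⟶ a), z'.app a ≫ C.comp f = C.L.pt := by
  have hp : C.L.pt ≫ C.p = z.app d := congr_arg LatchingFamily.pt C.post_p
  choose u hu hu' using fun a => C.exists_lift (z.app a) (fun _ => C.L.pt) (by simp [hp])
    (by simp)
  have hw {a b : SimplexCategory} (f : a ⟶ b) : u b ≫ C.attachMap f = u a :=
    C.attachObj_hom_ext (by simp [hu, reassoc_of% hu]) (by simp [hu'])
  exact ⟨⟨u, hw⟩, hu, hu'⟩

/-- The coaugmentation of `C.attach` induced by the one of `X`. -/
noncomputable def coaugmentation : Coaugmentation Z C.attach :=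
  C.exists_coaugmentation.choose

theorem coaugmentation_base (a : SimplexCategory) :
    C.coaugmentation.app a ≫ C.base a = z.app a :=
  C.exists_coaugmentation.choose_spec.1 a

theorem coaugmentation_comp {a : SimplexCategory} (f : d ⟶ a) :
    C.coaugmentation.app a ≫ C.comp f = C.L.pt :=
  C.exists_coaugmentation.choose_spec.2 a f

theorem isIso_base {a : SimplexCategory} (h : a.len < d.len) : IsIso (C.base a) := by
  have hm (f : d ⟶ a) : ¬ Mono f := not_mono_of_len_lt f h
  obtain ⟨u, hu, hu'⟩ := C.exists_lift (𝟙 (X.obj (op a))) (fun f => C.L.ext' f (hm f))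
    (fun f => by rw [LatchingFamily.ext'_comp_of_post_eq C.post_p, Category.id_comp]) (by simp)
  refine ⟨u, C.attachObj_hom_ext (by simp [hu]) fun f => ?_, hu⟩
  simp [C.comp_of_not_mono f (hm f), reassoc_of% hu]

theorem isIso_comp_id : IsIso (C.comp (𝟙 d)) := by
  classical
  have hm (f : d ⟶ d) (hf : f ≠ 𝟙 d) : ¬ Mono f := fun _ => hf (SimplexCategory.eq_id_of_mono f)
  obtain ⟨u, hu, hu'⟩ := C.exists_lift C.p
    (fun f => if hf : f = 𝟙 d then 𝟙 _ else C.p ≫ C.L.ext' f (hm f hf)) (by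
      intro f
      split_ifs with hf
      · subst hf; simp
      · rw [Category.assoc, LatchingFamily.ext'_comp_of_post_eq C.post_p]) (by
      intro f hf
      rw [dif_neg]
      rintro rfl
      exact hf inferInstance)
  refine ⟨u, C.attachObj_hom_ext (by simp [hu]) fun f => ?_, by simp [hu']⟩
  by_cases hf : f = 𝟙 d
  · subst hf; simp [hu']
  · simp [C.comp_of_not_mono f (hm f hf), reassoc_of% hu, reassoc_of% (C.comp_p (𝟙 d))]

theorem exists_lift_of_hasLiftingProperty {A B : M} (i : A ⟶ B) [HasLiftingProperty i C.p]
    {a : SimplexCategory} (x : B ⟶ X.obj (op a)) (w : A ⟶ C.attachObj a)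
    (hw : w ≫ C.base a = i ≫ x) (P : (d ⟶ a) → Prop) (y : ∀ f, P f → (B ⟶ C.Y))
    (hyp : ∀ f hf, y f hf ≫ C.p = x ≫ X.map f.op)
    (hyl : ∀ f hf hf', y f hf = x ≫ C.L.ext' f hf')
    (hyw : ∀ f hf, i ≫ y f hf = w ≫ C.comp f) :
    ∃ u : B ⟶ C.attachObj a, i ≫ u = w ∧ u ≫ C.base a = x ∧
      ∀ f hf, u ≫ C.comp f = y f hf := by
  have key (f : d ⟶ a) : ∃ t : B ⟶ C.Y, t ≫ C.p = x ≫ X.map f.op ∧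
      (∀ hf, t = x ≫ C.L.ext' f hf) ∧ i ≫ t = w ≫ C.comp f ∧ ∀ hf, t = y f hf := by
    by_cases hP : P f
    · exact ⟨y f hP, hyp f hP, hyl f hP, hyw f hP, fun _ => rfl⟩
    · by_cases hf : Mono f
      · have sq : CommSq (w ≫ C.comp f) i C.p (x ≫ X.map f.op) := ⟨by simp [reassoc_of% hw]⟩
        exact ⟨sq.lift, by simp, fun h => absurd hf h, by simp, fun h => absurd h hP⟩
      · refine ⟨x ≫ C.L.ext' f hf, ?_, fun _ => rfl, ?_, fun h => absurd h hP⟩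
        · rw [Category.assoc, LatchingFamily.ext'_comp_of_post_eq C.post_p]
        · rw [C.comp_of_not_mono f hf, reassoc_of% hw]
  choose t h1 h2 h3 h4 using key
  obtain ⟨u, hu, hu'⟩ := C.exists_lift x t h1 h2
  exact ⟨u, C.attachObj_hom_ext (by simp [hu, hw]) (by simp [hu', h3]), hu,
    fun f hf => by rw [hu', h4]⟩

theorem fib_base (S : ModelStructure M) (hp : S.Fib C.p) (a : SimplexCategory) :
    S.Fib (C.base a) := by
  refine S.fib_of_hasLiftingProperty _ fun i hi hi' => ⟨fun {w x} sq => ?_⟩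
  have := S.lift_acyclicCof_fib i C.p hi hi' hp
  obtain ⟨u, hu, hu', -⟩ := C.exists_lift_of_hasLiftingProperty i x w sq.w (fun _ => False)
    (fun _ h => h.elim) (fun _ h => h.elim) (fun _ h => h.elim) (fun _ h => h.elim)
  exact ⟨⟨⟨u, hu, hu'⟩⟩⟩

theorem fib_attachMap (S : ModelStructure M) (hp : S.Fib C.p) {a b : SimplexCategory}
    (g : a ⟶ b) [Mono g] (hg : S.Fib (X.map g.op)) : S.Fib (C.attachMap g) := by
  refine S.fib_of_hasLiftingProperty _ fun i hi hi' => ⟨fun {u v} sq => ?_⟩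
  have := S.lift_acyclicCof_fib i C.p hi hi' hp
  have := S.lift_acyclicCof_fib i _ hi hi' hg
  have sq' : CommSq (u ≫ C.base b) i (X.map g.op) (v ≫ C.base a) :=
    ⟨by rw [Category.assoc, ← C.attachMap_base, ← Category.assoc, sq.w, Category.assoc]⟩
  obtain ⟨w, hw, hw', hw''⟩ := C.exists_lift_of_hasLiftingProperty i sq'.lift u (by simp)
    (fun f => ∃ h, h ≫ g = f) (fun f hf => v ≫ C.comp hf.choose) (fun f hf => by
      conv_rhs => rw [← hf.choose_spec]
      simp [sq'.fac_right_assoc]) (fun f hf hf' => by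
      have hh : ¬ Mono hf.choose := fun h => hf' (by
        rw [← hf.choose_spec]; exact mono_comp _ _)
      have := C.L.map_ext' hf.choose hh g (by rwa [hf.choose_spec])
      simp only [hf.choose_spec] at this
      rw [← this, sq'.fac_right_assoc, C.comp_of_not_mono _ hh, Category.assoc]) (fun f hf => by
      rw [← sq.w_assoc, C.attachMap_comp, hf.choose_spec])
  refine ⟨⟨⟨w, hw, C.attachObj_hom_ext (by simp [reassoc_of% hw']) fun f => ?_⟩⟩⟩
  have hf : ∃ h, h ≫ g = f ≫ g := ⟨f, rfl⟩
  rw [Category.assoc, C.attachMap_comp, hw'' _ hf, (cancel_mono g).1 hf.choose_spec]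

end Cell

theorem acyclic_latching_of_iso (S : ModelStructure M) {X' : SimplicialObject M}
    {z : Coaugmentation Z X} {z' : Coaugmentation Z X'} (t : X' ⟶ X)
    (hz : ∀ a, z'.app a ≫ t.app (op a) = z.app a) {d : SimplexCategory}
    (ht : ∀ a : SimplexCategory, a.len < d.len → IsIso (t.app (op a))) {Y : M}
    (L : LatchingFamily z d Y) (hL : L.Acyclic S) (k : X'.obj (op d) ⟶ Y) [IsIso k]
    (hk : ∀ {a : SimplexCategory} (e : d ⟶ a) (he : IsDegeneracy e),
      X'.map e.op ≫ k = t.app (op a) ≫ L.map e he)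
    (hk' : z'.app d ≫ k = L.pt) : (z'.latching d).Acyclic S := by
  intro E B q hq φ b h
  have hm {a : SimplexCategory} (e : d ⟶ a) (he : IsDegeneracy e) :
      φ.map e he ≫ q = X'.map e.op ≫ b := by
    change (φ.post q).map e he = _
    rw [h]
    rfl
  have hpt : φ.pt ≫ q = z'.app d ≫ b := congr_arg LatchingFamily.pt h
  let φ' : LatchingFamily z d E :=
    { map := fun {a} e he => have := ht a he.2; inv (t.app (op a)) ≫ φ.map e he
      pt := φ.pt
      w := fun {a b} e he g hg => by
        have := ht a he.2
        have := ht b hg.2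
        rw [IsIso.eq_inv_comp, ← t.naturality_assoc, IsIso.hom_inv_id_assoc, φ.w]
      app_map := fun {a} e he => by
        have := ht a he.2
        simp [← hz] }
  obtain ⟨c, hc, hc'⟩ := hL q hq φ' (inv k ≫ b) (by
    ext a e he
    · have := ht a he.2
      simp only [φ', LatchingFamily.post_map, Category.assoc, hm]
      rw [IsIso.inv_comp_eq, ← reassoc_of% (hk e he)]
      simp
    · simp [φ', hpt, ← hk'])
  refine ⟨k ≫ c, by simp [hc], ?_⟩
  ext a e he
  · have := ht a he.2
    have h' : L.map e he ≫ c = inv (t.app (op a)) ≫ φ.map e he :=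
      congr_arg (fun ψ : LatchingFamily z d E => ψ.map e he) hc'
    simp [reassoc_of% (hk e he), h']
  · have h' : L.pt ≫ c = φ.pt := congr_arg LatchingFamily.pt hc'
    simp [reassoc_of% hk', h']

theorem Cell.acyclic_latching [HasFiniteLimits M] (S : ModelStructure M) {z : Coaugmentation Z X}
    {d : SimplexCategory} (C : Cell z d) (hC : C.L.Acyclic S) :
    (C.coaugmentation.latching d).Acyclic S := by
  let k : C.attach.obj (op d) ⟶ C.Y := C.comp (𝟙 d)
  have : IsIso k := C.isIso_comp_id
  refine acyclic_latching_of_iso S C.proj C.coaugmentation_base (fun a ha => C.isIso_base ha)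
    C.L hC k (fun {a} e he => ?_) (C.coaugmentation_comp _)
  change C.attachMap e ≫ C.comp (𝟙 d) = C.base a ≫ C.L.map e he
  simp [C.comp_of_not_mono e he.not_mono, C.L.ext'_of_isDegeneracy e he]

theorem exists_lift_of_acyclic_latching (S : ModelStructure M) (z : Coaugmentation Z X)
    (hz : ∀ d, (z.latching d).Acyclic S) {E B : M} (q : E ⟶ B) (hq : S.Fib q)
    (d : SimplexCategory) (α : Z ⟶ E) (β : X.obj (op d) ⟶ B) (h : α ≫ q = z.app d ≫ β) (k : ℕ) :
    ∃ φ : ∀ (a : SimplexCategory) (f : d ⟶ a), Epi f → a.len < k → (X.obj (op a) ⟶ E),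
      (∀ a b f hf ha (g : a ⟶ b) hg hb, X.map g.op ≫ φ a f hf ha = φ b (f ≫ g) hg hb) ∧
      (∀ a f hf ha, z.app a ≫ φ a f hf ha = α) ∧
      ∀ a f hf ha, φ a f hf ha ≫ q = X.map f.op ≫ β := by
  induction k with
  | zero => exact ⟨fun _ _ _ h => absurd h (by simp), fun _ _ _ _ h => absurd h (by simp),
      fun _ _ _ h => absurd h (by simp), fun _ _ _ h => absurd h (by simp)⟩
  | succ k ih =>
    obtain ⟨φ, h1, h2, h3⟩ := ih
    have key (a : SimplexCategory) (f : d ⟶ a) (hf : Epi f) (ha : a.len = k) :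
        ∃ c : X.obj (op a) ⟶ E, c ≫ q = X.map f.op ≫ β ∧ z.app a ≫ c = α ∧
          ∀ b (e : a ⟶ b) (he : IsDegeneracy e), X.map e.op ≫ c =
            φ b (f ≫ e) (have := he.1; epi_comp f e) (he.2.trans_eq ha) := by
      let ψ : LatchingFamily z a E :=
        { map := fun {b} e he =>
            φ b (f ≫ e) (have := he.1; epi_comp f e) (he.2.trans_eq ha)
          pt := α
          w := fun e he g hg => by
            have := hg.1
            rw [h1 _ _ _ _ _ _ (by simpa using epi_comp f (e ≫ g)) (hg.2.trans_eq ha)]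
            simp
          app_map := fun e he => h2 _ _ _ _ }
      obtain ⟨c, hc, hc'⟩ := hz a q hq ψ (X.map f.op ≫ β) (by
        ext
        · simp [ψ, h3]
        · simp [ψ, h, reassoc_of% (z.w f)])
      exact ⟨c, hc, congr_arg LatchingFamily.pt hc', fun b e he =>
        congr_arg (fun χ : LatchingFamily z a E => χ.map e he) hc'⟩
    choose c hc1 hc2 hc3 using key
    refine ⟨fun a f hf ha => if h' : a.len < k then φ a f hf h' else c a f hf (by lia),
      fun a b f hf ha g hg hb => ?_, fun a f hf ha => ?_, fun a f hf ha => ?_⟩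
    · dsimp only
      have : Epi g := epi_of_epi f g
      have hab := SimplexCategory.len_le_of_epi g
      by_cases ha' : a.len < k
      · rw [dif_pos ha', dif_pos (by lia), h1]
      · rw [dif_neg ha']
        by_cases hb' : b.len < k
        · rw [dif_pos hb', hc3 _ _ _ _ _ _ ⟨this, by lia⟩]
        · obtain rfl : b = a := SimplexCategory.ext (by lia)
          obtain rfl := SimplexCategory.eq_id_of_epi g
          simp [hb']
    · dsimp only
      split_ifs
      exacts [h2 _ _ _ _, hc2 _ _ _ _]
    · dsimp only
      split_ifs
      exacts [h3 _ _ _ _, hc1 _ _ _ _]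

theorem W_app_of_acyclic_latching (S : ModelStructure M) (z : Coaugmentation Z X)
    (hz : ∀ d, (z.latching d).Acyclic S) (d : SimplexCategory) : S.W (z.app d) := by
  refine S.W_of_hasLiftingProperty _ fun q hq => ⟨fun {α β} sq => ?_⟩
  obtain ⟨φ, -, h2, h3⟩ := exists_lift_of_acyclic_latching S z hz q hq d α β sq.w (d.len + 1)
  exact ⟨⟨⟨φ d (𝟙 d) inferInstance (by simp), h2 _ _ _ _, by simp [h3]⟩⟩⟩

/-- The simplices of `X` are determined by their restrictions to faces of dimension less
than `n`. -/
def IsCoskeletalBelow (X : SimplicialObject M) (n : ℕ) : Prop :=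
  ∀ (T : M) (d : SimplexCategory)
    (t : ∀ a : SimplexCategory, (a ⟶ d) → a.len < n → (T ⟶ X.obj (op a))),
    (∀ a b (h : b ⟶ a) g ha hb, t a g ha ≫ X.map h.op = t b (h ≫ g) hb) →
    ∃! x : T ⟶ X.obj (op d), ∀ a g ha, x ≫ X.map g.op = t a g ha

theorem IsCoskeletalBelow.hom_ext {n : ℕ} (hX : IsCoskeletalBelow X n) {T : M}
    {d : SimplexCategory} {u v : T ⟶ X.obj (op d)}
    (h : ∀ (a : SimplexCategory) (g : a ⟶ d), a.len < n → u ≫ X.map g.op = v ≫ X.map g.op) :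
    u = v :=
  (hX T d (fun _ g _ => v ≫ X.map g.op) (by simp)).unique h (by simp)

theorem Cell.existsUnique_of_isCoskeletalBelow [HasFiniteLimits M] {z : Coaugmentation Z X}
    {n : ℕ} (hX : IsCoskeletalBelow X n) (C : Cell z (SimplexCategory.mk n)) {T : M}
    {d : SimplexCategory}
    (t : ∀ a : SimplexCategory, (a ⟶ d) → a.len < n + 1 → (T ⟶ C.attachObj a))
    (ht : ∀ a b (h : b ⟶ a) g ha hb, t a g ha ≫ C.attachMap h = t b (h ≫ g) hb) :
    ∃! x : T ⟶ C.attachObj d, ∀ a g ha, x ≫ C.attachMap g = t a g ha := by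
  obtain ⟨x, hx, -⟩ := hX T d (fun a g ha => t a g (by lia) ≫ C.base a)
    (fun a b h g ha hb => by
      rw [Category.assoc, ← C.attachMap_base, reassoc_of% ht _ _ h g _ (by lia)])
  have hx' (a g ha) : x ≫ X.map g.op = t a g ha ≫ C.base a :=
    hX.hom_ext fun b h hb => by
      rw [Category.assoc, ← X.map_comp, ← op_comp, hx _ _ hb, ← ht _ _ h g ha, Category.assoc,
        C.attachMap_base, Category.assoc]
  have hn : (SimplexCategory.mk n).len < n + 1 := by simp
  obtain ⟨u, hu, hu'⟩ := C.exists_lift x (fun f => t _ f hn ≫ C.comp (𝟙 _))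
    (fun f => by rw [Category.assoc, C.comp_p, hx' _ f hn]; simp)
    (fun f hf => by
      have hs : IsDegeneracy (factorThruImage f) :=
        isDegeneracy_of_not_mono _ (image.ι f) (by simpa using hf)
      have h1 := ht _ _ (factorThruImage f) (image.ι f) (by have := hs.2; simp at this; lia) hn
      simp only [image.fac] at h1
      rw [← h1, Category.assoc, C.attachMap_comp, Category.id_comp,
        C.comp_of_not_mono _ hs.not_mono, ← Category.assoc, ← hx', C.L.ext'_of_isDegeneracy _ hs,
        LatchingFamily.ext', Category.assoc])
  refine ⟨u, fun a g ha => C.attachObj_hom_ext ?_ fun f => ?_, fun v hv => ?_⟩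
  · rw [Category.assoc, C.attachMap_base, reassoc_of% hu, hx' _ _ ha]
  · rw [Category.assoc, C.attachMap_comp, hu', ← ht _ _ f g ha, Category.assoc, C.attachMap_comp,
      Category.id_comp]
  · have hv' : v ≫ C.base d = x := hX.hom_ext fun a g ha => by
      rw [Category.assoc, ← C.attachMap_base, reassoc_of% hv _ g (by lia), hx _ _ ha]
    refine C.attachObj_hom_ext (hv'.trans hu.symm) fun f => ?_
    rw [hu', ← hv _ f hn, Category.assoc, C.attachMap_comp, Category.id_comp]

theorem Cell.isCoskeletalBelow_attach [HasFiniteLimits M] {z : Coaugmentation Z X} {n : ℕ}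
    (hX : IsCoskeletalBelow X n) (C : Cell z (SimplexCategory.mk n)) :
    IsCoskeletalBelow C.attach (n + 1) :=
  fun _ _ t ht => C.existsUnique_of_isCoskeletalBelow hX t ht

theorem exists_eq_comp_δ {m : ℕ} {a : SimplexCategory} (g : a ⟶ SimplexCategory.mk (m + 1))
    (ha : a.len < m + 1) :
    ∃ (k : Fin (m + 2)) (h : a ⟶ SimplexCategory.mk m), g = h ≫ SimplexCategory.δ k :=
  SimplexCategory.eq_comp_δ_of_not_surjective g fun hg => by
    have := SimplexCategory.epi_iff_surjective.2 hg
    exact (SimplexCategory.len_le_of_epi g).not_gt ha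

theorem IsCoskeletalBelow.hom_ext_of_faces {m : ℕ} (hX : IsCoskeletalBelow X (m + 1)) {T : M}
    {u v : T ⟶ X.obj (op (SimplexCategory.mk (m + 1)))} (h : ∀ k, u ≫ X.δ k = v ≫ X.δ k) :
    u = v :=
  hX.hom_ext fun a g ha => by
    obtain ⟨k, g, rfl⟩ := exists_eq_comp_δ g ha
    have h' : u ≫ X.map (SimplexCategory.δ k).op = v ≫ X.map (SimplexCategory.δ k).op := h k
    rw [op_comp, X.map_comp, reassoc_of% h']

theorem IsCoskeletalBelow.exists_of_faces {m : ℕ} (hX : IsCoskeletalBelow X (m + 1)) {T : M}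
    (t : Fin (m + 2) → (T ⟶ X.obj (op (SimplexCategory.mk m))))
    (ht : ∀ (a : SimplexCategory) (k k' : Fin (m + 2)) (g g' : a ⟶ SimplexCategory.mk m),
      g ≫ SimplexCategory.δ k = g' ≫ SimplexCategory.δ k' →
        t k ≫ X.map g.op = t k' ≫ X.map g'.op) :
    ∃ x : T ⟶ X.obj (op (SimplexCategory.mk (m + 1))), ∀ k, x ≫ X.δ k = t k := by
  choose k h hkh using fun (a : SimplexCategory) (g : a ⟶ SimplexCategory.mk (m + 1)) =>
    exists_eq_comp_δ g
  obtain ⟨x, hx, -⟩ := hX T _ (fun a g ha => t (k a g ha) ≫ X.map (h a g ha).op)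
    (fun a b f g ha hb => by
      rw [Category.assoc, ← X.map_comp, ← op_comp]
      exact ht _ _ _ _ _ (by rw [Category.assoc, ← hkh, ← hkh]))
  refine ⟨x, fun i => (hx _ _ (by simp)).trans ?_⟩
  rw [ht _ _ i _ (𝟙 _) (by rw [← hkh, Category.id_comp])]
  simp

theorem MatchingCompat.comp_eq {n : ℕ} {T : M}
    {t : Fin (n + 3) → (T ⟶ X.obj (op (SimplexCategory.mk (n + 1))))} (ht : MatchingCompat X n t)
    {a : SimplexCategory} {k k' : Fin (n + 3)} {g g' : a ⟶ SimplexCategory.mk (n + 1)}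
    (h : g ≫ SimplexCategory.δ k = g' ≫ SimplexCategory.δ k') :
    t k ≫ X.map g.op = t k' ≫ X.map g'.op := by
  wlog hk : k ≤ k' generalizing k k' g g'
  · exact (this h.symm (le_of_not_ge hk)).symm
  obtain rfl | hk := hk.eq_or_lt
  · rw [(cancel_mono _).1 h]
  obtain ⟨i, rfl⟩ := Fin.exists_castSucc_eq.2 (Fin.ne_last_of_lt hk)
  obtain ⟨j, rfl⟩ := Fin.exists_succ_eq.2 (Fin.ne_zero_of_lt hk)
  have hij : i ≤ j := Fin.castSucc_lt_succ_iff.1 hk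
  obtain ⟨e, rfl⟩ : ∃ e, g' = e ≫ SimplexCategory.δ i := by
    refine SimplexCategory.eq_comp_δ_of_not_surjective' g' i fun x hx => ?_
    have hv : i.castSucc.succAbove (g.toOrderHom x) = j.succ.succAbove (g'.toOrderHom x) :=
      congr_arg (fun φ => SimplexCategory.Hom.toOrderHom φ x) h
    rw [hx, Fin.succAbove_of_castSucc_lt _ _ (Fin.castSucc_lt_succ_iff.2 hij)] at hv
    exact Fin.succAbove_ne _ _ hv
  obtain rfl : g = e ≫ SimplexCategory.δ j := by
    rw [← cancel_mono (SimplexCategory.δ i.castSucc), h, Category.assoc, Category.assoc,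
      SimplexCategory.δ_comp_δ hij]
  have h' : t j.succ ≫ X.map (SimplexCategory.δ i).op =
    t i.castSucc ≫ X.map (SimplexCategory.δ j).op := ht i j hij
  simp [reassoc_of% h']

theorem comp_eq_of_comp_δ_eq_zero {T : M} (t : Fin 2 → (T ⟶ X.obj (op (SimplexCategory.mk 0))))
    {a : SimplexCategory} {k k' : Fin 2} {g g' : a ⟶ SimplexCategory.mk 0}
    (h : g ≫ SimplexCategory.δ k = g' ≫ SimplexCategory.δ k') :
    t k ≫ X.map g.op = t k' ≫ X.map g'.op := by
  obtain rfl : k = k' := by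
    have hv : k.succAbove (g.toOrderHom 0) = k'.succAbove (g'.toOrderHom 0) :=
      congr_arg (fun φ => SimplexCategory.Hom.toOrderHom φ 0) h
    rw [(Subsingleton.elim (α := Fin 1) (g.toOrderHom 0) (g'.toOrderHom 0))] at hv
    exact Fin.succAbove_left_injective.eq_iff.1 (by
      funext y
      rwa [Subsingleton.elim y (g'.toOrderHom 0)])
  rw [(cancel_mono _).1 h]

/-- A stage of the construction of a simplicial resolution. -/
structure Stage (S : ModelStructure M) (Z : M) (n : ℕ) where
  X : SimplicialObject M
  z : Coaugmentation Z X
  fib {a b : SimplexCategory} (g : a ⟶ b) [Mono g] : S.Fib (X.map g.op)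
  coskeletal : IsCoskeletalBelow X n

namespace Stage

variable [HasFiniteColimits M] {S : ModelStructure M} {Z : M} {n : ℕ} (s : Stage S Z n)

/-- A factorization of the relative matching map in dimension `n`. -/
noncomputable def cell : Cell s.z (SimplexCategory.mk n) :=
  (exists_cell S s.z _).choose

theorem fib_cell : S.Fib s.cell.p :=
  (exists_cell S s.z _).choose_spec.1

theorem acyclic_cell : s.cell.L.Acyclic S :=
  (exists_cell S s.z _).choose_spec.2

variable (S Z) [HasFiniteLimits M]

/-- The initial stage: the terminal simplicial object. -/
noncomputable def zero : Stage S Z 0 where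
  X := (Functor.const _).obj (⊤_ M)
  z := ⟨fun _ => terminal.from Z, fun _ => terminal.hom_ext _ _⟩
  fib g := S.fib_of_hasLiftingProperty _ fun _ _ _ => by dsimp; infer_instance
  coskeletal _ _ _ _ :=
    ⟨terminal.from _, fun _ _ h => absurd h (by simp), fun _ _ => terminal.hom_ext _ _⟩

variable {S Z}

/-- The next stage of the construction. -/
@[simps]
noncomputable def next : Stage S Z (n + 1) where
  X := s.cell.attach
  z := s.cell.coaugmentation
  fib g := s.cell.fib_attachMap S s.fib_cell g (s.fib g)
  coskeletal := s.cell.isCoskeletalBelow_attach s.coskeletal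

end Stage

section Tower

variable [HasFiniteLimits M] [HasFiniteColimits M] (S : ModelStructure M) (Z : M)

/-- The stages of the construction. -/
noncomputable def stage (n : ℕ) : Stage S Z n :=
  Nat.rec (Stage.zero S Z) (fun _ s => s.next) n

/-- The transition maps between the stages. -/
noncomputable def stageProj (n : ℕ) : (stage S Z (n + 1)).X ⟶ (stage S Z n).X :=
  (stage S Z n).cell.proj

/-- A limit of the stages: a simplicial object that agrees with the `n`th stage in dimensions
less than `n`. -/
structure StageLimit where
  Y : SimplicialObject M
  z : Coaugmentation Z Y
  π (n : ℕ) : Y ⟶ (stage S Z n).X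
  π_proj (n : ℕ) : π (n + 1) ≫ stageProj S Z n = π n
  z_π (n : ℕ) (a : SimplexCategory) : z.app a ≫ (π n).app (op a) = (stage S Z n).z.app a
  isIso_π (n : ℕ) (a : SimplexCategory) (h : a.len < n) : IsIso ((π n).app (op a))

theorem nonempty_stageLimit : Nonempty (StageLimit S Z) := by
  let F : ℕᵒᵖ ⥤ SimplicialObject M :=
    Functor.ofOpSequence (X := fun n => (stage S Z n).X) (stageProj S Z)
  have hF' (n : ℕ) : F.map (homOfLE (Nat.le_add_right n 1)).op = stageProj S Z n :=
    Functor.ofOpSequence_map_homOfLE_succ _ _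
  have hF (a : SimplexCategory) :
      (F.flip.obj (op a)).IsEventuallyConstantTo (op (a.len + 1)) := by
    rintro ⟨m⟩ f
    obtain ⟨k, rfl⟩ := Nat.exists_eq_add_of_le (leOfHom f.unop)
    obtain rfl : f = (homOfLE (by lia)).op := Subsingleton.elim _ _
    induction k with
    | zero => exact inferInstanceAs (IsIso ((F.flip.obj (op a)).map (𝟙 _)))
    | succ k ih =>
      have := ih
      have h : (homOfLE (show a.len + 1 ≤ a.len + 1 + (k + 1) by lia)).op =
          (homOfLE (Nat.le_add_right (a.len + 1 + k) 1)).op ≫ (homOfLE (by lia)).op :=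
        Subsingleton.elim _ _
      have : IsIso ((F.flip.obj (op a)).map
          (homOfLE (Nat.le_add_right (a.len + 1 + k) 1)).op) := by
        rw [Functor.flip_obj_map, hF']
        exact Cell.isIso_base _ (by simp; lia)
      rw [h, Functor.map_comp]
      infer_instance
  have (k : SimplexCategoryᵒᵖ) : HasLimit (F.flip.obj k) := (hF k.unop).hasLimit
  let l (k : SimplexCategoryᵒᵖ) : LimitCone (F.flip.obj k) := getLimitCone _
  let c : Cone F := combineCones F l
  have hc (a : SimplexCategory) : IsLimit (((evaluation _ M).obj (op a)).mapCone c) :=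
    IsLimit.ofIsoLimit (l (op a)).isLimit (evaluateCombinedCones F l (op a)).symm
  let s (a : SimplexCategory) : Cone (F ⋙ (evaluation _ M).obj (op a)) :=
    { pt := Z
      π := NatTrans.ofOpSequence (fun n => (stage S Z n).z.app a) (fun n => by
        rw [Functor.comp_map, hF' n]
        exact (Category.id_comp _).trans (Cell.coaugmentation_base _ a).symm) }
  refine ⟨⟨c.pt, ⟨fun a => (hc a).lift (s a), fun {a b} f => (hc a).hom_ext fun ⟨n⟩ => ?_⟩,
    fun n => c.π.app (op n), fun n => ?_, fun n a => ?_, fun n a ha => ?_⟩⟩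
  · have h1 : (hc b).lift (s b) ≫ (c.π.app (op n)).app (op b) = (stage S Z n).z.app b :=
      (hc b).fac (s b) (op n)
    have h2 : (hc a).lift (s a) ≫ (c.π.app (op n)).app (op a) = (stage S Z n).z.app a :=
      (hc a).fac (s a) (op n)
    have h3 : c.pt.map f.op ≫ (c.π.app (op n)).app (op a) =
      (c.π.app (op n)).app (op b) ≫ (stage S Z n).X.map f.op := (c.π.app (op n)).naturality f.op
    have h4 : (hc b).lift (s b) ≫ (c.π.app (op n)).app (op b) ≫ (stage S Z n).X.map f.op =
        (stage S Z n).z.app a :=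
      (Category.assoc _ _ _).symm.trans ((congr_arg (· ≫ _) h1).trans ((stage S Z n).z.w f))
    exact (Category.assoc _ _ _).trans ((congr_arg (_ ≫ ·) h3).trans (h4.trans h2.symm))
  · exact (congr_arg (c.π.app (op (n + 1)) ≫ ·) (hF' n).symm).trans (c.w _)
  · exact (hc a).fac (s a) (op n)
  · exact (hF a).isIso_π_of_isLimit' (hc a) (op n) (homOfLE ha).op

namespace StageLimit

variable {S Z} (l : StageLimit S Z)

theorem acyclic_latching (d : SimplexCategory) : (l.z.latching d).Acyclic S := by
  induction d using SimplexCategory.rec with | _ n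
  have := l.isIso_π (n + 1) (SimplexCategory.mk n) (by simp)
  have h : ((stage S Z (n + 1)).z.latching (SimplexCategory.mk n)).Acyclic S :=
    Cell.acyclic_latching S _ (stage S Z n).acyclic_cell
  exact acyclic_latching_of_iso S (l.π (n + 1)) (l.z_π _)
    (fun a ha => l.isIso_π _ _ (ha.trans (by simp))) _ h ((l.π (n + 1)).app _)
    (fun e he => (l.π _).naturality e.op) (l.z_π _ _)

theorem W_app (a : SimplexCategory) : S.W (l.z.app a) :=
  W_app_of_acyclic_latching S l.z l.acyclic_latching a

theorem W_map {a b : SimplexCategory} (f : a ⟶ b) : S.W (l.Y.map f.op) :=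
  S.W_of_comp_right _ _ (l.W_app b) (by rw [l.z.w]; exact l.W_app a)

theorem fib_map {a b : SimplexCategory} (f : a ⟶ b) [Mono f] : S.Fib (l.Y.map f.op) := by
  have := l.isIso_π (b.len + 1) b (by simp)
  have := l.isIso_π (b.len + 1) a (Nat.lt_succ_of_le (SimplexCategory.len_le_of_mono f))
  exact S.fib_of_iso _ _ ((l.π (b.len + 1)).app (op b)) ((l.π (b.len + 1)).app (op a))
    ((l.π _).naturality f.op).symm ((stage S Z _).fib f)

theorem fib_π_app (n : ℕ) : S.Fib ((l.π n).app (op (SimplexCategory.mk n))) := by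
  have := l.isIso_π (n + 1) (SimplexCategory.mk n) (by simp)
  refine S.fib_of_iso _ _ ((l.π (n + 1)).app _) (𝟙 _) ?_
    ((stage S Z n).cell.fib_base S (stage S Z n).fib_cell (SimplexCategory.mk n))
  rw [Category.comp_id, ← l.π_proj n]
  rfl

theorem fibrant : S.Fib (terminal.from (l.Y.obj (op (SimplexCategory.mk 0)))) := by
  have h : terminal.from _ = (l.π 0).app (op (SimplexCategory.mk 0)) := terminal.hom_ext _ _
  rw [h]
  exact l.fib_π_app 0

/-- The matching maps are fibrations. -/
theorem fib_of_faces (m : ℕ) {P : M}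
    (p : Fin (m + 2) → (P ⟶ l.Y.obj (op (SimplexCategory.mk m))))
    (hp : ∀ (a : SimplexCategory) (k k' : Fin (m + 2)) (g g' : a ⟶ SimplexCategory.mk m),
      g ≫ SimplexCategory.δ k = g' ≫ SimplexCategory.δ k' →
        p k ≫ l.Y.map g.op = p k' ≫ l.Y.map g'.op)
    (hom_ext : ∀ (T : M) (u v : T ⟶ P), (∀ k, u ≫ p k = v ≫ p k) → u = v)
    (f : l.Y.obj (op (SimplexCategory.mk (m + 1))) ⟶ P) (hf : ∀ k, f ≫ p k = l.Y.δ k) :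
    S.Fib f := by
  refine S.fib_of_hasLiftingProperty _ fun i hi hi' => ⟨fun {u v} sq => ?_⟩
  let q := (l.π (m + 1)).app (op (SimplexCategory.mk (m + 1)))
  let q' := (l.π (m + 1)).app (op (SimplexCategory.mk m))
  have : IsIso q' := l.isIso_π _ _ (by simp)
  have hq (k : Fin (m + 2)) : q ≫ (stage S Z (m + 1)).X.δ k = l.Y.δ k ≫ q' :=
    ((l.π _).naturality _).symm
  obtain ⟨x, hx⟩ := (stage S Z (m + 1)).coskeletal.exists_of_faces (fun k => v ≫ p k ≫ q')
    (fun a k k' g g' h => by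
      have h1 (g : a ⟶ SimplexCategory.mk m) : q' ≫ (stage S Z (m + 1)).X.map g.op =
        l.Y.map g.op ≫ (l.π (m + 1)).app (op a) := ((l.π _).naturality _).symm
      simp only [Category.assoc, h1]
      rw [reassoc_of% hp a k k' g g' h])
  have := S.lift_acyclicCof_fib i q hi hi' (l.fib_π_app _)
  have sq' : CommSq u i q x := ⟨(stage S Z (m + 1)).coskeletal.hom_ext_of_faces fun k => by
    rw [Category.assoc, Category.assoc, hq, hx, ← hf, Category.assoc, sq.w_assoc]⟩
  refine ⟨⟨⟨sq'.lift, sq'.fac_left, hom_ext _ _ _ fun k => ?_⟩⟩⟩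
  rw [← cancel_mono q', Category.assoc, Category.assoc, Category.assoc, reassoc_of% hf, ← hq,
    sq'.fac_right_assoc, hx]

end StageLimit

end Tower

end ModelCat
open ModelCat in
/-- **Existence of simplicial resolutions.**  In a closed model category admitting
finite limits and colimits, every object `Z` has a simplicial resolution: a simplicial
object `Y` which is a cosimplicial resolution in `Mᵒᵖ`, together with a weak
equivalence `Z ⟶ Y₀`. -/
theorem exists_simplicialResolution
    {M : Type u} [Category.{v} M] [HasFiniteLimits M] [HasFiniteColimits M]
    (S : ModelStructure M) (Z : M) :
    ∃ (Y : SimplicialObject M) (w : Z ⟶ Y.obj (op (SimplexCategory.mk 0))),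
      IsSimplicialResolution S Y ∧ S.W w := by
  obtain ⟨l⟩ := nonempty_stageLimit S Z
  refine ⟨l.Y, l.z.app _, ⟨l.fibrant, fun i => l.fib_map _, fun i => l.W_map _,
    fun P π hP f hf => ?_, fun n P π hπ hP f hf => ?_⟩, l.W_app _⟩
  · exact l.fib_of_faces 0 π (fun _ _ _ _ _ => comp_eq_of_comp_δ_eq_zero π)
      (fun T u v h => (hP T fun k => v ≫ π k).unique h fun _ => rfl) f hf
  · refine l.fib_of_faces (n + 1) π (fun _ _ _ _ _ => hπ.comp_eq)
      (fun T u v h => (hP T (fun k => v ≫ π k) fun i j hij => ?_).unique h fun _ => rfl) f hf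
    simp only [Category.assoc, hπ i j hij]
end

section
/- Let M be a closed model category admitting finite limits, and consider a commutative square in M with vertices W, X, Y, Z and maps W → X, W → Y, X → Z, Y → Z. Suppose given two choices of replacement data for the square: fibrant objects Z' and Z'', fibrations X' → Z', Y' → Z' and X'' → Z'', Y'' → Z'', and weak equivalences X → X', Y → Y', Z → Z' and X → X'', Y → Y'', Z → Z'' making the evident diagrams commute. Then the induced map W → X' ×_{Z'} Y' is a weak equivalence if and only if the induced map W → X'' ×_{Z''} Y'' is a weak equivalence. (Hence the notion of a homotopy cartesian square is independent of the choice of replacement data.) -/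
open CategoryTheory CategoryTheory.Limits Simplicial Opposite

universe v u


namespace ModelCat

variable {M : Type u} [Category.{v} M]

/-- Replacement data for a commutative square with right-bottom maps `cX : X ⟶ Z` and
`cY : Y ⟶ Z`: a fibrant object `Z'`, fibrations `pX : X' → Z'` and `pY : Y' → Z'`, and
weak equivalences `X → X'`, `Y → Y'`, `Z → Z'` such that the evident squares commute. -/
structure SquareReplacement [HasTerminal M] (S : ModelStructure M)
    {X Y Z : M} (cX : X ⟶ Z) (cY : Y ⟶ Z) where
  X' : M
  Y' : M
  Z' : M
  pX : X' ⟶ Z'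
  pY : Y' ⟶ Z'
  wX : X ⟶ X'
  wY : Y ⟶ Y'
  wZ : Z ⟶ Z'
  fibrant_Z' : S.Fibrant Z'
  fib_pX : S.Fib pX
  fib_pY : S.Fib pY
  weq_wX : S.W wX
  weq_wY : S.W wY
  weq_wZ : S.W wZ
  comm_X : wX ≫ pX = cX ≫ wZ
  comm_Y : wY ≫ pY = cY ≫ wZ

/-- The canonical map `W ⟶ X' ×_{Z'} Y'` induced by a commutative square (with top-left
corner `W`) and replacement data for it. -/
noncomputable def SquareReplacement.inducedMap [HasTerminal M] [HasPullbacks M]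
    {S : ModelStructure M} {W X Y Z : M} (a : W ⟶ X) (b : W ⟶ Y)
    {cX : X ⟶ Z} {cY : Y ⟶ Z} (comm : a ≫ cX = b ≫ cY)
    (D : SquareReplacement S cX cY) :
    W ⟶ pullback D.pX D.pY :=
  pullback.lift (a ≫ D.wX) (b ≫ D.wY) (by
    rw [Category.assoc, Category.assoc, D.comm_X, D.comm_Y, ← Category.assoc,
      ← Category.assoc, comm])

/-- A commutative square (`a ≫ cX = b ≫ cY`) is homotopy cartesian if for some
(equivalently, by the independence theorem, any) replacement data the induced map
`W ⟶ X' ×_{Z'} Y'` is a weak equivalence. -/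
def IsHomotopyCartesian [HasTerminal M] [HasPullbacks M] (S : ModelStructure M)
    {W X Y Z : M} (a : W ⟶ X) (b : W ⟶ Y) (cX : X ⟶ Z) (cY : Y ⟶ Z)
    (comm : a ≫ cX = b ≫ cY) : Prop :=
  ∃ D : SquareReplacement S cX cY, S.W (SquareReplacement.inducedMap a b comm D)

end ModelCat
namespace ModelCat

variable {M : Type u} [Category.{v} M]

attribute [local simp] pullback.lift_fst pullback.lift_snd pullback.lift_fst_assoc
  pullback.lift_snd_assoc prod.lift_fst prod.lift_snd

namespace ModelStructure

variable (S : ModelStructure M)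

lemma weq_of_rlp_cof {X Y : M} {f : X ⟶ Y} (hf : S.Cof.rlp f) : S.W f := by
  obtain ⟨Z, i, p, hi, -, hpW, rfl⟩ := S.factor_cof_acyclicFib f
  have := hf i hi
  have sq : CommSq (𝟙 X) i (i ≫ p) p := ⟨by simp⟩
  exact S.W_retract _ p
    ⟨Arrow.homMk i (𝟙 Y) (by simp), Arrow.homMk sq.lift (𝟙 Y) (by simp), by ext <;> simp⟩ hpW

lemma rlp_cof {X Y : M} {f : X ⟶ Y} (hf : S.Fib f) (hfW : S.W f) : S.Cof.rlp f :=
  fun _ _ i hi => S.lift_cof_acyclicFib i f hi hf hfW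

lemma fib_eq_rlp : S.Fib = (S.Cof ⊓ S.W).rlp := by
  ext X Y f
  refine ⟨fun hf _ _ i hi => S.lift_acyclicCof_fib i f hi.1 hi.2 hf, fun hf => ?_⟩
  obtain ⟨Z, i, p, hi, hiW, hp, rfl⟩ := S.factor_acyclicCof_fib f
  have := hf i ⟨hi, hiW⟩
  have sq : CommSq (𝟙 X) i (i ≫ p) p := ⟨by simp⟩
  exact S.Fib_retract _ p
    ⟨Arrow.homMk i (𝟙 Y) (by simp), Arrow.homMk sq.lift (𝟙 Y) (by simp), by ext <;> simp⟩ hp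

instance : S.Fib.IsMultiplicative := by
  rw [fib_eq_rlp]; infer_instance

instance : S.Fib.IsStableUnderBaseChange := by
  rw [fib_eq_rlp]; infer_instance

end ModelStructure

/-- If `Z₃ ⟶ Z₁`, `X₃ ⟶ X₁ ×_{Z₁} Z₃` and `Y₃ ⟶ Y₁ ×_{Z₁} Z₃` have the right lifting property
with respect to `T`, then so does `X₃ ×_{Z₃} Y₃ ⟶ X₁ ×_{Z₁} Y₁`. -/
lemma rlp_pullback_map [HasPullbacks M] (T : MorphismProperty M)
    {X₁ Y₁ Z₁ X₃ Y₃ Z₃ : M} {p₁ : X₁ ⟶ Z₁} {q₁ : Y₁ ⟶ Z₁} {p₃ : X₃ ⟶ Z₃} {q₃ : Y₃ ⟶ Z₃}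
    {u : X₃ ⟶ X₁} {t : Y₃ ⟶ Y₁} {h : Z₃ ⟶ Z₁} (hu : p₃ ≫ h = u ≫ p₁) (ht : q₃ ≫ h = t ≫ q₁)
    (hT : T.rlp h) (hTu : T.rlp (pullback.lift u p₃ hu.symm))
    (hTt : T.rlp (pullback.lift t q₃ ht.symm)) :
    T.rlp (pullback.map p₃ q₃ p₁ q₁ u t h hu ht) := by
  intro A B i hi
  have := hT i hi
  have := hTu i hi
  have := hTt i hi
  refine ⟨fun {f g} sq => ?_⟩
  have sqX : f ≫ pullback.fst p₃ q₃ ≫ u = i ≫ g ≫ pullback.fst p₁ q₁ := by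
    simpa using sq.w =≫ pullback.fst p₁ q₁
  have sqY : f ≫ pullback.snd p₃ q₃ ≫ t = i ≫ g ≫ pullback.snd p₁ q₁ := by
    simpa using sq.w =≫ pullback.snd p₁ q₁
  have sqZ : CommSq (f ≫ pullback.fst p₃ q₃ ≫ p₃) i h (g ≫ pullback.fst p₁ q₁ ≫ p₁) :=
    ⟨by simpa [hu] using sqX =≫ p₁⟩
  have sqX' : CommSq (f ≫ pullback.fst p₃ q₃) i (pullback.lift u p₃ hu.symm)
      (pullback.lift (g ≫ pullback.fst p₁ q₁) sqZ.lift (by simp)) :=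
    ⟨by ext <;> simp [sqX]⟩
  have sqY' : CommSq (f ≫ pullback.snd p₃ q₃) i (pullback.lift t q₃ ht.symm)
      (pullback.lift (g ≫ pullback.snd p₁ q₁) sqZ.lift (by simp [pullback.condition])) :=
    ⟨by ext <;> simp [sqY, pullback.condition]⟩
  have hXu : sqX'.lift ≫ u = g ≫ pullback.fst p₁ q₁ := by
    simpa [-CommSq.fac_right, -CommSq.fac_right_assoc] using
      sqX'.fac_right =≫ pullback.fst _ _
  have hXp : sqX'.lift ≫ p₃ = sqZ.lift := by
    simpa [-CommSq.fac_right, -CommSq.fac_right_assoc] using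
      sqX'.fac_right =≫ pullback.snd _ _
  have hYt : sqY'.lift ≫ t = g ≫ pullback.snd p₁ q₁ := by
    simpa [-CommSq.fac_right, -CommSq.fac_right_assoc] using
      sqY'.fac_right =≫ pullback.fst _ _
  have hYq : sqY'.lift ≫ q₃ = sqZ.lift := by
    simpa [-CommSq.fac_right, -CommSq.fac_right_assoc] using
      sqY'.fac_right =≫ pullback.snd _ _
  exact ⟨⟨⟨pullback.lift sqX'.lift sqY'.lift (hXp.trans hYq.symm),
    by ext <;> simp, by ext <;> simp [hXu, hYt]⟩⟩⟩

namespace SquareReplacement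

variable [HasFiniteLimits M] {S : ModelStructure M} {X Y Z : M} {cX : X ⟶ Z} {cY : Y ⟶ Z}

/-- A morphism of replacement data `D ⟶ E`, under the given square, such that `Z' ⟶ Z''`,
`X' ⟶ X'' ×_{Z''} Z'` and `Y' ⟶ Y'' ×_{Z''} Z'` are acyclic fibrations. -/
structure AcyclicFibration (D E : SquareReplacement S cX cY) where
  homX : D.X' ⟶ E.X'
  homY : D.Y' ⟶ E.Y'
  homZ : D.Z' ⟶ E.Z'
  comm_pX : D.pX ≫ homZ = homX ≫ E.pX
  comm_pY : D.pY ≫ homZ = homY ≫ E.pY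
  wX_homX : D.wX ≫ homX = E.wX
  wY_homY : D.wY ≫ homY = E.wY
  rlp_homZ : S.Cof.rlp homZ
  rlp_liftX : S.Cof.rlp (pullback.lift homX D.pX comm_pX.symm)
  rlp_liftY : S.Cof.rlp (pullback.lift homY D.pY comm_pY.symm)

lemma AcyclicFibration.inducedMap_weq_iff {D E : SquareReplacement S cX cY}
    (φ : AcyclicFibration D E) {W : M} (a : W ⟶ X) (b : W ⟶ Y) (comm : a ≫ cX = b ≫ cY) :
    S.W (inducedMap a b comm D) ↔ S.W (inducedMap a b comm E) := by
  have hW := S.weq_of_rlp_cof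
    (rlp_pullback_map S.Cof φ.comm_pX φ.comm_pY φ.rlp_homZ φ.rlp_liftX φ.rlp_liftY)
  have fac : inducedMap a b comm D ≫ pullback.map _ _ _ _ _ _ _ φ.comm_pX φ.comm_pY =
      inducedMap a b comm E := by
    ext <;> simp [inducedMap, φ.wX_homX, φ.wY_homY]
  rw [← fac]
  exact ⟨fun h => S.W_comp _ _ h hW, fun h => S.W_of_comp_left _ _ hW h⟩

end SquareReplacement

namespace ModelStructure

variable [HasFiniteLimits M] (S : ModelStructure M)

/-- Two fibrant replacements of an object are dominated by a third one. -/
lemma exists_common_fibrant_replacement {Z Z₁ Z₂ : M} (w₁ : Z ⟶ Z₁) (w₂ : Z ⟶ Z₂)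
    (hw₁ : S.W w₁) (hw₂ : S.W w₂) (hZ₁ : S.Fibrant Z₁) (hZ₂ : S.Fibrant Z₂) :
    ∃ (Z₃ : M) (w : Z ⟶ Z₃) (h₁ : Z₃ ⟶ Z₁) (h₂ : Z₃ ⟶ Z₂), S.W w ∧ S.Fibrant Z₃ ∧
      S.Cof.rlp h₁ ∧ S.Cof.rlp h₂ ∧ w ≫ h₁ = w₁ ∧ w ≫ h₂ = w₂ := by
  obtain ⟨Z₃, w, p, -, hw, hp, fac⟩ := S.factor_acyclicCof_fib (prod.lift w₁ w₂)
  have fac₁ : w ≫ p ≫ prod.fst = w₁ := by simpa using fac =≫ prod.fst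
  have fac₂ : w ≫ p ≫ prod.snd = w₂ := by simpa using fac =≫ prod.snd
  have sq : IsPullback (prod.fst : Z₁ ⨯ Z₂ ⟶ Z₁) prod.snd (terminal.from Z₁)
      (terminal.from Z₂) := IsPullback.of_is_product' (prodIsProd Z₁ Z₂) terminalIsTerminal
  have hp₁ : S.Fib (p ≫ prod.fst) :=
    S.Fib.comp_mem _ _ hp (S.Fib.of_isPullback sq.flip hZ₂)
  have hp₂ : S.Fib (p ≫ prod.snd) :=
    S.Fib.comp_mem _ _ hp (S.Fib.of_isPullback sq hZ₁)
  refine ⟨Z₃, w, p ≫ prod.fst, p ≫ prod.snd, hw, ?_,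
    S.rlp_cof hp₁ (S.W_of_comp_right w _ hw (by rwa [fac₁])),
    S.rlp_cof hp₂ (S.W_of_comp_right w _ hw (by rwa [fac₂])), fac₁, fac₂⟩
  have := S.Fib.comp_mem _ _ hp₁ hZ₁
  rwa [terminal.comp_from] at this

/-- Two fibrant replacements of `c : X ⟶ Z` over acyclic fibrations `h₁` and `h₂` are dominated
by a third one. -/
lemma exists_common_fibration_replacement {X Z Z₁ Z₂ Z₃ X₁ X₂ : M} (c : X ⟶ Z) (w : Z ⟶ Z₃)
    (h₁ : Z₃ ⟶ Z₁) (h₂ : Z₃ ⟶ Z₂) (hh₁ : S.Cof.rlp h₁) (hh₂ : S.Cof.rlp h₂)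
    (p₁ : X₁ ⟶ Z₁) (p₂ : X₂ ⟶ Z₂) (hp₁ : S.Fib p₁) (hp₂ : S.Fib p₂)
    (w₁ : X ⟶ X₁) (w₂ : X ⟶ X₂) (hw₁ : S.W w₁) (hw₂ : S.W w₂)
    (comm₁ : w₁ ≫ p₁ = c ≫ w ≫ h₁) (comm₂ : w₂ ≫ p₂ = c ≫ w ≫ h₂) :
    ∃ (X₃ : M) (p : X₃ ⟶ Z₃) (w₃ : X ⟶ X₃) (u₁ : X₃ ⟶ X₁) (u₂ : X₃ ⟶ X₂)
      (e₁ : p ≫ h₁ = u₁ ≫ p₁) (e₂ : p ≫ h₂ = u₂ ≫ p₂),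
      S.Fib p ∧ S.W w₃ ∧ w₃ ≫ p = c ≫ w ∧ w₃ ≫ u₁ = w₁ ∧ w₃ ≫ u₂ = w₂ ∧
      S.Cof.rlp (pullback.lift u₁ p e₁.symm) ∧ S.Cof.rlp (pullback.lift u₂ p e₂.symm) := by
  let l₁ : X ⟶ pullback p₁ h₁ := pullback.lift w₁ (c ≫ w) (by simpa using comm₁)
  let l₂ : X ⟶ pullback p₂ h₂ := pullback.lift w₂ (c ≫ w) (by simpa using comm₂)
  have hl₁ : S.W l₁ := S.W_of_comp_left _ (pullback.fst _ _)
    (S.weq_of_rlp_cof (S.Cof.rlp.pullback_fst _ _ hh₁)) (by simpa [l₁] using hw₁)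
  have hl₂ : S.W l₂ := S.W_of_comp_left _ (pullback.fst _ _)
    (S.weq_of_rlp_cof (S.Cof.rlp.pullback_fst _ _ hh₂)) (by simpa [l₂] using hw₂)
  have hs₁ : S.Fib (pullback.snd p₁ h₁) := S.Fib.pullback_snd _ _ hp₁
  have hs₂ : S.Fib (pullback.snd p₂ h₂) := S.Fib.pullback_snd _ _ hp₂
  obtain ⟨X₃, w₃, r, -, hw₃, hr, fac⟩ := S.factor_acyclicCof_fib
    (pullback.lift l₁ l₂ (by simp [l₁, l₂]) :
      X ⟶ pullback (pullback.snd p₁ h₁) (pullback.snd p₂ h₂))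
  let r₁ := r ≫ pullback.fst _ _
  let r₂ := r ≫ pullback.snd _ _
  have hr₁ : S.Fib r₁ := S.Fib.comp_mem _ _ hr (S.Fib.pullback_fst _ _ hs₂)
  have hr₂ : S.Fib r₂ := S.Fib.comp_mem _ _ hr (S.Fib.pullback_snd _ _ hs₁)
  have fac₁ : w₃ ≫ r₁ = l₁ := by simpa [r₁] using fac =≫ pullback.fst _ _
  have fac₂ : w₃ ≫ r₂ = l₂ := by simpa [r₂] using fac =≫ pullback.snd _ _
  have e : r₁ ≫ pullback.snd _ _ = r₂ ≫ pullback.snd _ _ := by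
    simp [r₁, r₂, pullback.condition]
  have e₁ : (r₁ ≫ pullback.snd _ _) ≫ h₁ = (r₁ ≫ pullback.fst _ _) ≫ p₁ := by
    simp [pullback.condition]
  have e₂ : (r₁ ≫ pullback.snd _ _) ≫ h₂ = (r₂ ≫ pullback.fst _ _) ≫ p₂ := by
    rw [e]; simp [pullback.condition]
  have eq₁ : pullback.lift _ _ e₁.symm = r₁ := by ext <;> simp
  have eq₂ : pullback.lift _ _ e₂.symm = r₂ := by ext <;> simp [e]
  refine ⟨X₃, r₁ ≫ pullback.snd _ _, w₃, r₁ ≫ pullback.fst _ _, r₂ ≫ pullback.fst _ _, e₁, e₂,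
    S.Fib.comp_mem _ _ hr₁ hs₁, hw₃, ?_, ?_, ?_, ?_, ?_⟩
  · rw [reassoc_of% fac₁]; simp [l₁]
  · rw [reassoc_of% fac₁]; simp [l₁]
  · rw [reassoc_of% fac₂]; simp [l₂]
  · rw [eq₁]
    exact S.rlp_cof hr₁ (S.W_of_comp_right w₃ _ hw₃ (by rwa [fac₁]))
  · rw [eq₂]
    exact S.rlp_cof hr₂ (S.W_of_comp_right w₃ _ hw₃ (by rwa [fac₂]))

end ModelStructure

lemma SquareReplacement.exists_acyclicFibration [HasFiniteLimits M] {S : ModelStructure M}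
    {X Y Z : M} {cX : X ⟶ Z} {cY : Y ⟶ Z} (D₁ D₂ : SquareReplacement S cX cY) :
    ∃ D : SquareReplacement S cX cY,
      Nonempty (AcyclicFibration D D₁) ∧ Nonempty (AcyclicFibration D D₂) := by
  obtain ⟨Z₃, w, h₁, h₂, hw, hZ₃, hh₁, hh₂, fac₁, fac₂⟩ :=
    S.exists_common_fibrant_replacement D₁.wZ D₂.wZ D₁.weq_wZ D₂.weq_wZ
      D₁.fibrant_Z' D₂.fibrant_Z'
  obtain ⟨X₃, p, wX, u₁, u₂, eX₁, eX₂, hp, hwX, commX, facX₁, facX₂, hu₁, hu₂⟩ :=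
    S.exists_common_fibration_replacement cX w h₁ h₂ hh₁ hh₂ D₁.pX D₂.pX D₁.fib_pX D₂.fib_pX
      D₁.wX D₂.wX D₁.weq_wX D₂.weq_wX (by rw [fac₁, D₁.comm_X]) (by rw [fac₂, D₂.comm_X])
  obtain ⟨Y₃, q, wY, t₁, t₂, eY₁, eY₂, hq, hwY, commY, facY₁, facY₂, ht₁, ht₂⟩ :=
    S.exists_common_fibration_replacement cY w h₁ h₂ hh₁ hh₂ D₁.pY D₂.pY D₁.fib_pY D₂.fib_pY
      D₁.wY D₂.wY D₁.weq_wY D₂.weq_wY (by rw [fac₁, D₁.comm_Y]) (by rw [fac₂, D₂.comm_Y])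
  exact ⟨⟨X₃, Y₃, Z₃, p, q, wX, wY, w, hZ₃, hp, hq, hwX, hwY, hw, commX, commY⟩,
    ⟨⟨u₁, t₁, h₁, eX₁, eY₁, facX₁, facY₁, hh₁, hu₁, ht₁⟩⟩,
    ⟨⟨u₂, t₂, h₂, eX₂, eY₂, facX₂, facY₂, hh₂, hu₂, ht₂⟩⟩⟩

end ModelCat

open ModelCat in
/-- **Independence of the homotopy cartesian property from the choice of replacement
data.**  Given a commutative square in a closed model category with finite limits and
two choices of replacement data, the induced map to the pullback of the first
replacement is a weak equivalence if and only if the induced map to the pullback of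
the second one is. -/
theorem squareReplacement_inducedMap_weq_iff
    {M : Type u} [Category.{v} M] [HasFiniteLimits M]
    (S : ModelStructure M) {W X Y Z : M}
    (a : W ⟶ X) (b : W ⟶ Y) (cX : X ⟶ Z) (cY : Y ⟶ Z)
    (comm : a ≫ cX = b ≫ cY)
    (D₁ D₂ : SquareReplacement S cX cY) :
    S.W (SquareReplacement.inducedMap a b comm D₁) ↔
      S.W (SquareReplacement.inducedMap a b comm D₂) := by
  obtain ⟨D, ⟨φ₁⟩, ⟨φ₂⟩⟩ := D₁.exists_acyclicFibration D₂
  exact (φ₁.inducedMap_weq_iff a b comm).symm.trans (φ₂.inducedMap_weq_iff a b comm)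
end
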